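/- For every α ∈ (1,2), the series defining k_α(x) converges absolutely for every x > 0, k_α is nonnegative on (0,∞), and for every real s with 1 − α < s < α and s ≠ 1 one has ∫₀^∞ x^s · k_α(x) dx = Γ(1−s/α)·sin(π/α) / (Γ(1−s)·sin(π(1−s)/α)); in particular (taking s = 0) ∫₀^∞ k_α(x) dx = 1. -/

import Mathlib

open Real MeasureTheory Set

/-- The density `k_α` of the supremum at time 1 of a normalized spectrally
positive `α`-stable Lévy process:
`k_α(x) = Σ_{n≥1} x^{αn−2}/(Γ(αn−1) Γ(1+1/α−n))`. -/
noncomputable def supDensity (α x : ℝ) : ℝ :=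
  ∑' n : ℕ, x ^ (α * ((n : ℝ) + 1) - 2) /
    (Real.Gamma (α * ((n : ℝ) + 1) - 1) * Real.Gamma (1 + 1 / α - ((n : ℝ) + 1)))

section Auxiliary

open Filter Topology

lemma rpow_mul_Gamma_le_Gamma_add {x a : ℝ} (hx : 0 < x) (ha : 1 < a) :
    x ^ a * Real.Gamma x ≤ Real.Gamma (x + a) := by
  have h := Real.convexOn_log_Gamma.slope_mono_adjacent (x := x) (y := x + 1) (z := x + a)
    hx (show (0 : ℝ) < x + a by linarith) (by linarith) (by linarith)
  simp only [Function.comp] at h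
  have hG := Real.Gamma_pos_of_pos hx
  rw [Real.Gamma_add_one hx.ne', Real.log_mul hx.ne' hG.ne', le_div_iff₀ (by linarith)] at h
  have h2 : a * Real.log x + Real.log (Real.Gamma x) ≤ Real.log (Real.Gamma (x + a)) := by
    have : (Real.log x + Real.log (Real.Gamma x) - Real.log (Real.Gamma x)) / (x + 1 - x)
        * (x + a - (x + 1)) = (a - 1) * Real.log x := by
      rw [show x + 1 - x = 1 by ring]; ring
    linarith
  have h3 := Real.exp_le_exp.2 h2
  rw [Real.exp_add, Real.exp_log hG,
    Real.exp_log (Real.Gamma_pos_of_pos (by linarith : 0 < x + a)), mul_comm a,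
    ← Real.rpow_def_of_pos hx] at h3
  exact h3

lemma summable_pow_mul_Gamma_div_Gamma {α b c R : ℝ} (hα : 1 < α) (hb : 0 < b) (hc : 0 < c)
    (hR : 0 ≤ R) :
    Summable fun n : ℕ => R ^ n * (Real.Gamma (n + c) / Real.Gamma (α * n + b)) := by
  set K : ℝ := max 1 (c / b)
  have hK : ∀ n : ℕ, (n : ℝ) + c ≤ K * (α * n + b) := fun n => by
    have h1 : 1 ≤ K := le_max_left _ _
    have h2 : c / b ≤ K := le_max_right _ _
    rw [div_le_iff₀ hb] at h2
    have hn : (0 : ℝ) ≤ n := n.cast_nonneg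
    have : (n : ℝ) ≤ K * (α * n) := by nlinarith [mul_le_mul h1 hα.le zero_le_one (by linarith)]
    linarith
  have hlim : Tendsto (fun n : ℕ => R * K * (α * (n : ℝ) + b) ^ (-(α - 1))) atTop (𝓝 (R * K * 0)) := by
    refine Tendsto.const_mul _ ((tendsto_rpow_neg_atTop (by linarith)).comp ?_)
    exact tendsto_atTop_add_const_right _ _
      (tendsto_natCast_atTop_atTop.const_mul_atTop (by linarith))
  rw [mul_zero] at hlim
  refine summable_of_ratio_norm_eventually_le (r := 1 / 2) (by norm_num) ?_
  filter_upwards [hlim.eventually (gt_mem_nhds (by norm_num : (0 : ℝ) < 1 / 2))] with n hn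
  have hn0 : (0 : ℝ) ≤ n := n.cast_nonneg
  have hB : 0 < α * n + b := by positivity
  have hGc := Real.Gamma_pos_of_pos (by positivity : 0 < (n : ℝ) + c)
  have hGb := Real.Gamma_pos_of_pos hB
  have e1 : Real.Gamma ((n + 1 : ℕ) + c) = (n + c) * Real.Gamma (n + c) := by
    rw [← Real.Gamma_add_one (by positivity)]; congr 1; push_cast; ring
  have e2 : α * ((n + 1 : ℕ) : ℝ) + b = (α * n + b) + α := by push_cast; ring
  have e3 := rpow_mul_Gamma_le_Gamma_add hB hα
  rw [e1, e2]
  have hpos : 0 < (α * n + b) ^ α := Real.rpow_pos_of_pos hB _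
  rw [Real.norm_of_nonneg (by positivity), Real.norm_of_nonneg (by positivity)]
  calc R ^ (n + 1) * ((n + c) * Real.Gamma (n + c) / Real.Gamma (α * n + b + α))
      ≤ R ^ (n + 1) * (K * (α * n + b) * Real.Gamma (n + c) /
          ((α * n + b) ^ α * Real.Gamma (α * n + b))) := by
        gcongr
        exact hK n
    _ = (R * K * (α * n + b) ^ (-(α - 1))) *
          (R ^ n * (Real.Gamma (n + c) / Real.Gamma (α * n + b))) := by
        rw [neg_sub, Real.rpow_sub hB, Real.rpow_one]
        field_simp
        ring
    _ ≤ _ := by gcongr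

lemma summable_pow_div_Gamma {α b R : ℝ} (hα : 1 < α) (hb : 0 < b) (hR : 0 ≤ R) :
    Summable fun n : ℕ => R ^ n / Real.Gamma (α * n + b) := by
  refine (summable_pow_mul_Gamma_div_Gamma hα hb one_pos hR).of_nonneg_of_le
    (fun n => ?_) fun n => ?_
  · have := Real.Gamma_pos_of_pos (by positivity : 0 < α * n + b)
    positivity
  · have := Real.Gamma_pos_of_pos (by positivity : 0 < α * n + b)
    rw [div_eq_mul_one_div, Real.Gamma_nat_eq_factorial]
    gcongr
    exact_mod_cast n.factorial_pos

/-- The entire function `u ↦ E_{α,b}(-u)` of Mittag-Leffler type. -/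
noncomputable def mittagLefflerNeg (α b u : ℝ) : ℝ :=
  ∑' n : ℕ, (-1) ^ n * u ^ n / Real.Gamma (α * n + b)

/-- The Mittag-Leffler kernel `y ^ (b - 1) E_{α,b}(-y ^ α)`. -/
noncomputable def mlKernel (α b y : ℝ) : ℝ :=
  y ^ (b - 1) * mittagLefflerNeg α b (y ^ α)

lemma continuous_mittagLefflerNeg {α b : ℝ} (hα : 1 < α) (hb : 0 < b) :
    Continuous (mittagLefflerNeg α b) := by
  rw [continuous_iff_continuousAt]
  intro u
  have hmem : Metric.ball (0 : ℝ) (|u| + 1) ∈ 𝓝 u :=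
    Metric.isOpen_ball.mem_nhds (by simp)
  refine ContinuousOn.continuousAt (s := Metric.ball (0 : ℝ) (|u| + 1)) ?_ hmem
  refine continuousOn_tsum (fun n => by fun_prop)
    (summable_pow_div_Gamma hα hb (by positivity : 0 ≤ |u| + 1)) fun n x hx => ?_
  have hG := Real.Gamma_pos_of_pos (by positivity : 0 < α * n + b)
  rw [norm_div, norm_mul, norm_pow, norm_neg, norm_one, one_pow, one_mul, norm_pow,
    Real.norm_of_nonneg hG.le]
  have : ‖x‖ ≤ |u| + 1 := by simpa using (mem_ball_zero_iff.1 hx).le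
  gcongr

lemma continuousOn_mlKernel {α b : ℝ} (hα : 1 < α) (hb : 0 < b) :
    ContinuousOn (mlKernel α b) (Ioi 0) := by
  refine ContinuousOn.mul (fun y hy => ?_) ?_
  · exact (Real.continuousAt_rpow_const _ _ (Or.inl (ne_of_gt hy))).continuousWithinAt
  · exact ((continuous_mittagLefflerNeg hα hb).comp
      (Real.continuous_rpow_const (by linarith))).continuousOn

lemma mlKernel_eq_tsum {α b y : ℝ} (hy : 0 < y) :
    mlKernel α b y = ∑' n : ℕ, (-1) ^ n * y ^ (α * n + b - 1) / Real.Gamma (α * n + b) := by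
  rw [mlKernel, mittagLefflerNeg, ← tsum_mul_left]
  congr 1 with n
  rw [← Real.rpow_natCast (y ^ α) n, ← Real.rpow_mul hy.le,
    show α * n + b - 1 = (b - 1) + α * n by ring, Real.rpow_add hy]
  ring

lemma integrable_tsum_of_summable_integral_norm {X : Type*} [MeasurableSpace X] {μ : Measure X}
    {F : ℕ → X → ℝ} (hF : ∀ n, Integrable (F n) μ)
    (hs : Summable fun n => ∫ x, ‖F n x‖ ∂μ)
    (hm : AEStronglyMeasurable (fun x => ∑' n, F n x) μ) :
    Integrable (fun x => ∑' n, F n x) μ := by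
  refine ⟨hm, ?_⟩
  have hle : ∫⁻ x, ‖∑' n, F n x‖ₑ ∂μ ≤ ∑' n, ∫⁻ x, ‖F n x‖ₑ ∂μ := by
    rw [← lintegral_tsum fun n => (hF n).1.enorm]
    exact lintegral_mono fun x => enorm_tsum_le_tsum_enorm
  refine hle.trans_lt ?_
  have (n : ℕ) : ∫⁻ x, ‖F n x‖ₑ ∂μ = ENNReal.ofReal (∫ x, ‖F n x‖ ∂μ) :=
    (ofReal_integral_norm_eq_lintegral_enorm (hF n)).symm
  simp_rw [this]
  exact hs.tsum_ofReal_lt_top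

/-- Termwise integration of a Mittag-Leffler kernel against a nonnegative weight. -/
lemma integral_mul_mlKernel {α b : ℝ} (hα : 1 < α) (hb : 0 < b) {W : ℝ → ℝ} {V : ℕ → ℝ}
    (hW : ContinuousOn W (Ioi 0)) (hW0 : ∀ y, 0 < y → 0 ≤ W y)
    (hi : ∀ n : ℕ, IntegrableOn (fun y => W y * y ^ (α * n + b - 1)) (Ioi 0))
    (hV : ∀ n : ℕ, ∫ y in Ioi 0, W y * y ^ (α * n + b - 1) = V n)
    (hs : Summable fun n : ℕ => V n / Real.Gamma (α * n + b)) :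
    IntegrableOn (fun y => W y * mlKernel α b y) (Ioi 0) ∧
      ∫ y in Ioi 0, W y * mlKernel α b y = ∑' n : ℕ, (-1) ^ n * (V n / Real.Gamma (α * n + b)) := by
  set F : ℕ → ℝ → ℝ := fun n y =>
    ((-1) ^ n / Real.Gamma (α * n + b)) * (W y * y ^ (α * n + b - 1))
  have hFe : ∀ y ∈ Ioi (0 : ℝ), ∑' n, F n y = W y * mlKernel α b y := fun y hy => by
    rw [mlKernel_eq_tsum hy, ← tsum_mul_left]
    congr 1 with n
    simp only [F]; ring
  have hF : ∀ n, Integrable (F n) (volume.restrict (Ioi 0)) := fun n => (hi n).const_mul _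
  have hn : ∀ n, ∫ y in Ioi 0, ‖F n y‖ = V n / Real.Gamma (α * n + b) := fun n => by
    have hG := Real.Gamma_pos_of_pos (by positivity : 0 < α * n + b)
    rw [← hV n, div_eq_inv_mul, ← integral_const_mul]
    refine setIntegral_congr_fun measurableSet_Ioi fun y hy => ?_
    have h1 := hW0 y hy
    have h2 := Real.rpow_nonneg (le_of_lt hy) (α * n + b - 1)
    simp only [F]
    rw [norm_mul, norm_div, norm_pow, norm_neg, norm_one, one_pow, Real.norm_of_nonneg hG.le,
      Real.norm_of_nonneg (mul_nonneg h1 h2), one_div]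
  have hs' : Summable fun n => ∫ y in Ioi 0, ‖F n y‖ := by simpa only [hn] using hs
  have hm : AEStronglyMeasurable (fun y => W y * mlKernel α b y) (volume.restrict (Ioi 0)) :=
    (hW.mul (continuousOn_mlKernel hα hb)).aestronglyMeasurable measurableSet_Ioi
  have hae : (fun y => ∑' n, F n y) =ᵐ[volume.restrict (Ioi 0)] fun y => W y * mlKernel α b y :=
    (ae_restrict_iff' measurableSet_Ioi).2 (.of_forall hFe)
  refine ⟨(integrable_tsum_of_summable_integral_norm hF hs' (hm.congr hae.symm)).congr hae, ?_⟩
  rw [← integral_congr_ae hae, ← integral_tsum_of_summable_integral_norm hF hs']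
  congr 1 with n
  rw [← hV n]
  simp only [F]
  rw [integral_const_mul]
  ring

lemma laplace_mlKernel {α b l : ℝ} (hα : 1 < α) (hb : 0 < b) (hl : 1 < l) :
    IntegrableOn (fun y => rexp (-(l * y)) * mlKernel α b y) (Ioi 0) ∧
      ∫ y in Ioi 0, rexp (-(l * y)) * mlKernel α b y = l ^ (α - b) / (1 + l ^ α) := by
  have hl0 : 0 < l := by linarith
  have hr1 : l ^ (-α) < 1 := Real.rpow_lt_one_of_one_lt_of_neg hl (by linarith)
  have hr0 : 0 < l ^ (-α) := Real.rpow_pos_of_pos hl0 _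
  have hpos : ∀ n : ℕ, 0 < α * n + b := fun n => by positivity
  have hterm : ∀ n : ℕ, Real.Gamma (α * n + b) * (1 / l) ^ (α * n + b) / Real.Gamma (α * n + b)
      = l ^ (-b) * (l ^ (-α)) ^ n := fun n => by
    have hG := Real.Gamma_pos_of_pos (hpos n)
    rw [mul_div_cancel_left₀ _ hG.ne', one_div, Real.inv_rpow hl0.le, ← Real.rpow_neg hl0.le,
      ← Real.rpow_natCast, ← Real.rpow_mul hl0.le, ← Real.rpow_add hl0]
    congr 1; ring
  have := integral_mul_mlKernel hα hb (W := fun y => rexp (-(l * y)))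
    (V := fun n => Real.Gamma (α * n + b) * (1 / l) ^ (α * n + b)) (by fun_prop)
    (fun y _ => (Real.exp_pos _).le) (fun n => ?_) (fun n => ?_) ?_
  · refine ⟨this.1, this.2.trans ?_⟩
    simp_rw [hterm]
    have : ∀ n : ℕ, (-1) ^ n * (l ^ (-b) * (l ^ (-α)) ^ n) = l ^ (-b) * (-l ^ (-α)) ^ n :=
      fun n => by rw [neg_pow (l ^ (-α)) n]; ring
    simp_rw [this]
    rw [tsum_mul_left, tsum_geometric_of_norm_lt_one
      (by rw [norm_neg, Real.norm_of_nonneg hr0.le]; exact hr1), Real.rpow_sub hl0,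
      Real.rpow_neg hl0.le, Real.rpow_neg hl0.le]
    have := Real.rpow_pos_of_pos hl0 α
    have := Real.rpow_pos_of_pos hl0 b
    rw [show 1 - -(l ^ α)⁻¹ = (1 + l ^ α) / l ^ α by field_simp; ring]
    field_simp
  · have := integrableOn_rpow_mul_exp_neg_mul_rpow (p := 1) (s := α * n + b - 1) (b := l)
      (by linarith [hpos n]) one_pos hl0
    refine this.congr_fun (fun y _ => ?_) measurableSet_Ioi
    simp only [Real.rpow_one]
    rw [mul_comm, neg_mul]
  · rw [← (Real.integral_rpow_mul_exp_neg_mul_Ioi (hpos n) hl0).trans (mul_comm _ _)]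
    simp_rw [mul_comm]
  · simp_rw [hterm]
    exact (summable_geometric_of_lt_one hr0.le hr1).mul_left _

/-- The Laplace transform of a real function on `(0, ∞)`. -/
noncomputable def lap (q : ℝ → ℝ) (p : ℂ) : ℂ :=
  ∫ y in Ioi (0 : ℝ), Complex.exp (-(p * y)) * (q y : ℂ)

lemma norm_cexp_neg_mul_ofReal (p : ℂ) (y : ℝ) :
    ‖Complex.exp (-(p * y))‖ = rexp (-(p.re * y)) := by
  simp [Complex.norm_exp]

lemma aestronglyMeasurable_of_integrableOn_exp_mul {q : ℝ → ℝ} {c : ℝ}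
    (h : IntegrableOn (fun y => rexp (-(c * y)) * q y) (Ioi 0)) :
    AEStronglyMeasurable q (volume.restrict (Ioi 0)) := by
  have : AEStronglyMeasurable (fun y => rexp (c * y) * (rexp (-(c * y)) * q y))
      (volume.restrict (Ioi 0)) :=
    (by fun_prop : Continuous fun y => rexp (c * y)).aestronglyMeasurable.mul h.1
  refine this.congr (.of_forall fun y => ?_)
  simp only
  rw [← mul_assoc, ← Real.exp_add, add_neg_cancel, Real.exp_zero, one_mul]

lemma integrableOn_cexp_mul {q : ℝ → ℝ} {p : ℂ}
    (h : IntegrableOn (fun y => rexp (-(p.re * y)) * q y) (Ioi 0)) :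
    IntegrableOn (fun y : ℝ => Complex.exp (-(p * y)) * (q y : ℂ)) (Ioi 0) := by
  refine (integrable_norm_iff ?_).1 (h.norm.congr (.of_forall fun y => ?_))
  · have := aestronglyMeasurable_of_integrableOn_exp_mul h
    exact (by fun_prop : Continuous fun y : ℝ => Complex.exp (-(p * y))).aestronglyMeasurable.mul
      (Complex.continuous_ofReal.comp_aestronglyMeasurable this)
  · simp only [norm_mul, norm_cexp_neg_mul_ofReal, Complex.norm_real]
    rw [Real.norm_of_nonneg (Real.exp_pos _).le]

lemma exp_mul_id_le {c d y : ℝ} (hd : d < c) :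
    y * rexp (-(c * y)) ≤ 1 / (c - d) * rexp (-(d * y)) := by
  have h := Real.add_one_le_exp ((c - d) * y)
  have h2 : rexp ((c - d) * y) * rexp (-(c * y)) = rexp (-(d * y)) := by
    rw [← Real.exp_add]; congr 1; ring
  rw [← h2, ← mul_assoc]
  refine mul_le_mul_of_nonneg_right ?_ (Real.exp_pos _).le
  rw [one_div, le_inv_mul_iff₀ (by linarith)]
  linarith

lemma integrableOn_exp_mul_id_mul {q : ℝ → ℝ} {c₀ : ℝ}
    (h : ∀ c, c₀ < c → IntegrableOn (fun y => rexp (-(c * y)) * q y) (Ioi 0)) :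
    ∀ c, c₀ < c → IntegrableOn (fun y => rexp (-(c * y)) * (y * q y)) (Ioi 0) := by
  intro c hc
  have h1 := h ((c + c₀) / 2) (by linarith)
  have hm := aestronglyMeasurable_of_integrableOn_exp_mul h1
  refine (h1.norm.const_mul (1 / (c - (c + c₀) / 2))).mono' ?_ ?_
  · exact (by fun_prop : Continuous fun y => rexp (-(c * y))).aestronglyMeasurable.mul
      (continuous_id.aestronglyMeasurable.mul hm)
  · refine (ae_restrict_iff' measurableSet_Ioi).2 (.of_forall fun y hy => ?_)
    have := exp_mul_id_le (c := c) (d := (c + c₀) / 2) (y := y) (by linarith)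
    rw [norm_mul, norm_mul, norm_mul, Real.norm_of_nonneg (Real.exp_pos _).le,
      Real.norm_of_nonneg (Real.exp_pos _).le, Real.norm_of_nonneg (le_of_lt hy), ← mul_assoc,
      ← mul_assoc]
    refine mul_le_mul_of_nonneg_right ?_ (norm_nonneg _)
    rwa [mul_comm]

lemma hasDerivAt_lap {q : ℝ → ℝ} {c₀ : ℝ}
    (h : ∀ c, c₀ < c → IntegrableOn (fun y => rexp (-(c * y)) * q y) (Ioi 0)) {p : ℂ}
    (hp : c₀ < p.re) : HasDerivAt (lap q) (-lap (fun y => y * q y) p) p := by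
  have hs : {z : ℂ | (p.re + c₀) / 2 < z.re} ∈ 𝓝 p :=
    (isOpen_lt continuous_const Complex.continuous_re).mem_nhds
      (show (p.re + c₀) / 2 < p.re by linarith)
  have h' := integrableOn_exp_mul_id_mul h
  have hb := h' ((p.re + c₀) / 2) (by linarith)
  have hmq := aestronglyMeasurable_of_integrableOn_exp_mul (h p.re hp)
  have hmc : AEStronglyMeasurable (fun y => (q y : ℂ)) (volume.restrict (Ioi 0)) :=
    Complex.continuous_ofReal.comp_aestronglyMeasurable hmq
  have := (hasDerivAt_integral_of_dominated_loc_of_deriv_le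
    (μ := volume.restrict (Ioi (0 : ℝ)))
    (F := fun (z : ℂ) (y : ℝ) => Complex.exp (-(z * y)) * (q y : ℂ))
    (F' := fun (z : ℂ) (y : ℝ) => -(Complex.exp (-(z * y)) * ((y * q y : ℝ) : ℂ)))
    (bound := fun y => ‖rexp (-((p.re + c₀) / 2 * y)) * (y * q y)‖) (x₀ := p)
    hs (.of_forall fun z => ?_) (integrableOn_cexp_mul (h p.re hp)) ?_ ?_ hb.norm ?_).2
  · rw [integral_neg] at this
    exact this
  · exact (by fun_prop : Continuous fun y : ℝ => Complex.exp (-(z * y))).aestronglyMeasurable.mul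
      hmc
  · exact (integrableOn_cexp_mul (h' p.re hp)).1.neg
  · refine (ae_restrict_iff' measurableSet_Ioi).2 (.of_forall fun y hy z hz => ?_)
    rw [norm_neg, norm_mul, norm_cexp_neg_mul_ofReal, Complex.norm_real, norm_mul (rexp _),
      Real.norm_of_nonneg (Real.exp_pos _).le]
    refine mul_le_mul_of_nonneg_right (Real.exp_le_exp.2 ?_) (norm_nonneg _)
    have : (p.re + c₀) / 2 * y ≤ z.re * y :=
      mul_le_mul_of_nonneg_right (le_of_lt hz) (le_of_lt hy)
    linarith
  · refine .of_forall fun y z _ => ?_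
    have h1 : HasDerivAt (fun z : ℂ => -(z * (y : ℂ))) (-(1 * (y : ℂ))) z :=
      ((hasDerivAt_id z).mul_const _).neg
    have h2 := (h1.cexp.mul_const (q y : ℂ))
    convert! h2 using 1
    push_cast; ring

lemma isOpen_re_gt (c : ℝ) : IsOpen {p : ℂ | c < p.re} :=
  isOpen_lt continuous_const Complex.continuous_re

lemma lap_ofReal (q : ℝ → ℝ) (l : ℝ) :
    lap q l = ((∫ y in Ioi 0, rexp (-(l * y)) * q y : ℝ) : ℂ) := by
  rw [lap, ← integral_complex_ofReal]
  congr 1 with y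
  push_cast; rfl

/-- A formula for a Laplace transform valid for large real arguments extends to the half-plane. -/
lemma lap_eq_of_eq_on_real {q : ℝ → ℝ} {Ψ : ℂ → ℂ} {c₀ c₁ : ℝ}
    (h : ∀ c, c₀ < c → IntegrableOn (fun y => rexp (-(c * y)) * q y) (Ioi 0))
    (hΨ : DifferentiableOn ℂ Ψ {p : ℂ | c₀ < p.re})
    (he : ∀ l : ℝ, c₁ < l → lap q l = Ψ l) {p : ℂ} (hp : c₀ < p.re) : lap q p = Ψ p := by
  have hU := isOpen_re_gt c₀
  have h1 : AnalyticOnNhd ℂ (lap q) {p : ℂ | c₀ < p.re} :=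
    DifferentiableOn.analyticOnNhd
      (fun z hz => (hasDerivAt_lap h hz).differentiableAt.differentiableWithinAt) hU
  set l₀ : ℝ := max c₀ c₁ + 1
  have hl₀ : c₀ < l₀ := (le_max_left c₀ c₁).trans_lt (lt_add_one _)
  have hl₁ : c₁ < l₀ := (le_max_right c₀ c₁).trans_lt (lt_add_one _)
  refine h1.eqOn_of_preconnected_of_frequently_eq (hΨ.analyticOnNhd hU)
    (convex_halfSpace_re_gt c₀).isPreconnected (z₀ := (l₀ : ℂ)) (by simpa using hl₀) ?_ hp
  have ht : Tendsto (fun n : ℕ => ((l₀ + 1 / ((n : ℝ) + 1) : ℝ) : ℂ)) atTop (𝓝[≠] (l₀ : ℂ)) := by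
    refine tendsto_nhdsWithin_iff.2 ⟨?_, .of_forall fun n => ?_⟩
    · refine (Complex.continuous_ofReal.tendsto l₀).comp ?_
      simpa using (tendsto_one_div_add_atTop_nhds_zero_nat (𝕜 := ℝ)).const_add l₀
    · have : (0 : ℝ) < 1 / ((n : ℝ) + 1) := by positivity
      simp only [mem_compl_iff, mem_singleton_iff, Complex.ofReal_inj]
      linarith
  refine ht.frequently (Frequently.of_forall fun n => he _ ?_)
  have : (0 : ℝ) < 1 / ((n : ℝ) + 1) := by positivity
  linarith

lemma continuous_indicator_Ioi_zero {q : ℝ → ℝ} (hq : ContinuousOn q (Ioi 0))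
    (hq0 : Tendsto q (𝓝[>] 0) (𝓝 0)) : Continuous ((Ioi 0).indicator q) := by
  rw [continuous_iff_continuousAt]
  intro y
  rcases lt_trichotomy y 0 with hy | rfl | hy
  · refine (continuousAt_const (y := (0 : ℝ))).congr ?_
    filter_upwards [Iio_mem_nhds hy] with z hz
    rw [indicator_of_notMem (by simpa using le_of_lt hz)]
  · rw [continuousAt_iff_continuous_left'_right']
    have h0 : (Ioi (0 : ℝ)).indicator q 0 = 0 := by simp
    constructor
    · rw [ContinuousWithinAt, h0]
      refine tendsto_const_nhds.congr' ?_
      filter_upwards [self_mem_nhdsWithin] with z hz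
      rw [indicator_of_notMem (by simpa using le_of_lt hz)]
    · rw [ContinuousWithinAt, h0]
      refine hq0.congr' ?_
      filter_upwards [self_mem_nhdsWithin] with z hz
      rw [indicator_of_mem hz]
  · refine (hq.continuousAt (Ioi_mem_nhds hy)).congr ?_
    filter_upwards [Ioi_mem_nhds hy] with z hz
    rw [indicator_of_mem hz]

lemma bromwich {q : ℝ → ℝ} {c : ℝ} (hq : ContinuousOn q (Ioi 0))
    (hq0 : Tendsto q (𝓝[>] 0) (𝓝 0))
    (hi : IntegrableOn (fun y => rexp (-(c * y)) * q y) (Ioi 0))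
    (hI : Integrable fun x : ℝ => lap q (c + x * Complex.I)) {y : ℝ} (hy : 0 < y) :
    ∫ x : ℝ, Complex.exp ((c + x * Complex.I) * y) * lap q (c + x * Complex.I)
      = 2 * π * q y := by
  set f : ℝ → ℂ := fun v => (((Ioi 0).indicator (fun y => rexp (-(c * y)) * q y) v : ℝ) : ℂ)
  have hfc : Continuous f := by
    refine Complex.continuous_ofReal.comp (continuous_indicator_Ioi_zero ?_ ?_)
    · exact (by fun_prop : Continuous fun y => rexp (-(c * y))).continuousOn.mul hq
    · have : Tendsto (fun y => rexp (-(c * y))) (𝓝[>] 0) (𝓝 (rexp (-(c * 0)))) :=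
        ((by fun_prop : Continuous fun y => rexp (-(c * y))).tendsto 0).mono_left
          nhdsWithin_le_nhds
      simpa using this.mul hq0
  have hfi : Integrable f := ((integrable_indicator_iff measurableSet_Ioi).2 hi).ofReal
  have hF : ∀ w : ℝ, FourierTransform.fourier f w = lap q (c + (2 * π * w : ℝ) * Complex.I) := by
    intro w
    rw [Real.fourier_real_eq_integral_exp_smul, lap, ← integral_indicator measurableSet_Ioi]
    congr 1 with v
    simp only [f]
    by_cases hv : v ∈ Ioi (0 : ℝ)
    · rw [indicator_of_mem hv, indicator_of_mem hv, smul_eq_mul]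
      push_cast
      rw [← mul_assoc, ← Complex.exp_add]
      congr 2; ring
    · rw [indicator_of_notMem hv, indicator_of_notMem hv]; simp
  have h2π : (2 * π) ≠ 0 := by positivity
  have hFi : Integrable (FourierTransform.fourier f) := by
    have := hI.comp_mul_left' h2π
    refine this.congr (.of_forall fun w => ?_)
    rw [hF]
  have key := congrFun (hfc.fourierInv_fourier_eq hfi hFi) y
  rw [Real.fourierInv_eq'] at key
  have e : f y = rexp (-(c * y)) * q y := by
    simp only [f]; rw [indicator_of_mem (mem_Ioi.2 hy)]; push_cast; rfl
  rw [e] at key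
  set G : ℝ → ℂ := fun x => Complex.exp ((c + x * Complex.I) * y) * lap q (c + x * Complex.I)
  have hG : ∀ w : ℝ, G (2 * π * w) = Complex.exp (c * y) *
      (Complex.exp (((2 * π * inner ℝ w y : ℝ) : ℂ) * Complex.I) • FourierTransform.fourier f w) := by
    intro w
    rw [hF, smul_eq_mul, ← mul_assoc, ← Complex.exp_add]
    simp only [G]
    congr 2
    simp only [RCLike.inner_apply, conj_trivial]
    push_cast; ring
  have h3 := Measure.integral_comp_mul_left G (2 * π)
  simp_rw [hG] at h3
  rw [integral_const_mul, key, ← mul_assoc] at h3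
  have h4 : Complex.exp (c * y) * (rexp (-(c * y)) : ℝ) = 1 := by
    push_cast
    rw [← Complex.exp_add, add_neg_cancel, Complex.exp_zero]
  rw [h4, one_mul, abs_of_pos (by positivity), Complex.real_smul] at h3
  change ∫ x, G x = _
  rw [h3]
  push_cast
  field_simp

lemma abs_le_of_lap_bound {q : ℝ → ℝ} {Ψ : ℂ → ℂ} {B : ℝ → ℝ} (hq : ContinuousOn q (Ioi 0))
    (hq0 : Tendsto q (𝓝[>] 0) (𝓝 0))
    (hi : ∀ c, 1 < c → IntegrableOn (fun y => rexp (-(c * y)) * q y) (Ioi 0))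
    (hΨ : DifferentiableOn ℂ Ψ {p : ℂ | 0 < p.re}) (he : ∀ p : ℂ, 1 < p.re → lap q p = Ψ p)
    (hB : ∀ p : ℂ, 0 < p.re → p.im ≠ 0 → ‖Ψ p‖ ≤ B p.im) (hBi : Integrable B)
    (hBt : Tendsto B atTop (𝓝 0)) (hBb : Tendsto B atBot (𝓝 0)) {y : ℝ} (hy : 0 < y) :
    2 * π * |q y| ≤ ∫ x, B x := by
  set F : ℂ → ℂ := fun p => Complex.exp (p * y) * Ψ p
  have hF : DifferentiableOn ℂ F {p : ℂ | 0 < p.re} :=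
    (by fun_prop : Differentiable ℂ fun p : ℂ => Complex.exp (p * y)).differentiableOn.mul hΨ
  have hline : ∀ c : ℝ, 0 < c → Continuous fun x : ℝ => Ψ (c + x * Complex.I) := fun c hc =>
    hΨ.continuousOn.comp_continuous (by fun_prop) fun x => by simpa using hc
  have hne : ∀ᵐ x : ℝ, x ≠ 0 := by simp [ae_iff]
  have hΨi : ∀ c : ℝ, 0 < c → Integrable fun x : ℝ => Ψ (c + x * Complex.I) := fun c hc => by
    refine hBi.mono' (hline c hc).aestronglyMeasurable ?_
    filter_upwards [hne] with x hx
    simpa using hB (c + x * Complex.I) (by simpa using hc) (by simpa using hx)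
  have hnF : ∀ p : ℂ, 0 < p.re → p.im ≠ 0 → ‖F p‖ ≤ rexp (p.re * y) * B p.im := fun p hp hp' => by
    simp only [F]
    rw [norm_mul, Complex.norm_exp, show (p * y).re = p.re * y by simp]
    exact mul_le_mul_of_nonneg_left (hB p hp hp') (Real.exp_pos _).le
  have hB0 : ∀ x : ℝ, x ≠ 0 → 0 ≤ B x := fun x hx =>
    (norm_nonneg _).trans (by simpa using hB (1 + x * Complex.I) (by simp) (by simpa using hx))
  have hFi : ∀ c : ℝ, 0 < c → Integrable fun x : ℝ => F (c + x * Complex.I) := fun c hc => by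
    refine (hBi.const_mul (rexp (c * y))).mono' ?_ ?_
    · exact (hF.continuousOn.comp_continuous (by fun_prop)
        fun x => by simpa using hc).aestronglyMeasurable
    · filter_upwards [hne] with x hx
      simpa using hnF (c + x * Complex.I) (by simpa using hc) (by simpa using hx)
  have hbrom : ∫ x : ℝ, F (2 + x * Complex.I) = 2 * π * q y := by
    have e : ∀ x : ℝ, lap q ((2 : ℝ) + x * Complex.I) = Ψ ((2 : ℝ) + x * Complex.I) := fun x =>
      he _ (by simp)
    have := bromwich (c := 2) hq hq0 (hi 2 (by norm_num))
      ((hΨi 2 two_pos).congr (.of_forall fun x => (e x).symm)) hy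
    simp_rw [e] at this
    simpa [F] using this
  have hlim2 : Tendsto (fun T : ℝ => ‖∫ x in (-T)..T, F (2 + x * Complex.I)‖) atTop
      (𝓝 (2 * π * |q y|)) := by
    have h := intervalIntegral_tendsto_integral (by simpa using hFi 2 two_pos)
      tendsto_neg_atTop_atBot tendsto_id
    rw [hbrom] at h
    have h2 := h.norm
    have e : ‖(2 * π * q y : ℂ)‖ = 2 * π * |q y| := by
      simp [abs_of_pos Real.pi_pos]
    rwa [e] at h2
  have hmain : ∀ c : ℝ, 0 < c → c < 2 → 2 * π * |q y| ≤ rexp (c * y) * ∫ x, B x := by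
    intro c hc hc2
    have hbd : ∀ T : ℝ, 0 < T → ‖∫ x in (-T)..T, F (2 + x * Complex.I)‖ ≤
        rexp (c * y) * (∫ x, B x) + (2 - c) * rexp (2 * y) * (B T + B (-T)) := by
      intro T hT
      have hrect := Complex.integral_boundary_rect_eq_zero_of_differentiableOn F
        (c + (-T : ℝ) * Complex.I) (2 + T * Complex.I) (hF.mono fun p hp => ?_)
      · simp only [Complex.add_re, Complex.ofReal_re, Complex.mul_re, Complex.I_re, mul_zero,
          Complex.ofReal_im, Complex.I_im, mul_one, sub_self, add_zero, Complex.add_im,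
          Complex.mul_im, zero_add, Complex.re_ofNat, Complex.im_ofNat] at hrect
        have hh : ∀ S : ℝ, S ≠ 0 → ‖∫ x : ℝ in c..2, F (x + S * Complex.I)‖ ≤
            (rexp (2 * y) * B S) * |2 - c| := fun S hS => by
          refine intervalIntegral.norm_integral_le_of_norm_le_const fun x hx => ?_
          rw [uIoc_of_le hc2.le] at hx
          have := hnF (x + S * Complex.I) (by simpa using hc.trans hx.1) (by simpa using hS)
          simp only [Complex.add_re, Complex.ofReal_re, Complex.mul_re, Complex.I_re, mul_zero,
            Complex.ofReal_im, Complex.I_im, mul_one, sub_self, add_zero, Complex.add_im,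
            Complex.mul_im, zero_add] at this
          refine this.trans ?_
          have hb := hB0 S hS
          have := hx.2
          gcongr
        have hv : ‖∫ x : ℝ in (-T)..T, F (c + x * Complex.I)‖ ≤ rexp (c * y) * ∫ x, B x := by
          rw [intervalIntegral.integral_of_le (by linarith)]
          refine (norm_integral_le_integral_norm _).trans ?_
          refine (setIntegral_le_integral (hFi c hc).norm
            (.of_forall fun x => norm_nonneg _)).trans ?_
          rw [← integral_const_mul]
          refine integral_mono_ae (hFi c hc).norm (hBi.const_mul _) ?_
          filter_upwards [hne] with x hx
          simpa using hnF (c + x * Complex.I) (by simpa using hc) (by simpa using hx)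
        have h1 := hh T hT.ne'
        have h2 := hh (-T) (by simpa using hT.ne')
        rw [abs_of_pos (by linarith)] at h1 h2
        set I₁ := ∫ x : ℝ in c..2, F (x + (-T : ℝ) * Complex.I)
        set I₂ := ∫ x : ℝ in c..2, F (x + T * Complex.I)
        set J := ∫ x : ℝ in (-T)..T, F (c + x * Complex.I)
        set J₂ := ∫ x : ℝ in (-T)..T, F (2 + x * Complex.I)
        have h3 : Complex.I • J₂ = Complex.I • J + (I₂ - I₁) := by linear_combination hrect
        have h4 : ‖J₂‖ = ‖Complex.I • J₂‖ := by simp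
        have h5 : ‖Complex.I • J‖ = ‖J‖ := by simp
        rw [h4, h3]
        refine (norm_add_le _ _).trans ?_
        rw [h5]
        have := norm_sub_le I₂ I₁
        linarith
      · have := hp.1
        simp only [Complex.add_re, Complex.ofReal_re, Complex.mul_re, Complex.I_re, mul_zero,
          Complex.ofReal_im, Complex.I_im, mul_one, sub_self, add_zero, Complex.re_ofNat] at this
        rw [mem_preimage, uIcc_of_le hc2.le] at this
        exact hc.trans_le this.1
    have hlim : Tendsto (fun T : ℝ => rexp (c * y) * (∫ x, B x) +
        (2 - c) * rexp (2 * y) * (B T + B (-T))) atTop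
        (𝓝 (rexp (c * y) * (∫ x, B x) + (2 - c) * rexp (2 * y) * (0 + 0))) :=
      ((hBt.add (hBb.comp tendsto_neg_atTop_atBot)).const_mul _).const_add _
    rw [add_zero, mul_zero, add_zero] at hlim
    refine le_of_tendsto_of_tendsto hlim2 hlim ?_
    filter_upwards [eventually_gt_atTop 0] with T hT using hbd T hT
  have hlim3 : Tendsto (fun c : ℝ => rexp (c * y) * ∫ x, B x) (𝓝[>] 0)
      (𝓝 (rexp (0 * y) * ∫ x, B x)) :=
    ((by fun_prop : Continuous fun c : ℝ => rexp (c * y) * ∫ x, B x).tendsto 0).mono_left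
      nhdsWithin_le_nhds
  rw [zero_mul, Real.exp_zero, one_mul] at hlim3
  refine ge_of_tendsto hlim3 ?_
  filter_upwards [Ioo_mem_nhdsGT (by norm_num : (0 : ℝ) < 2)] with c hc
  exact hmain c hc.1 hc.2

lemma exists_norm_one_add_cpow_ge {α : ℝ} (h1 : 1 < α) (h2 : α < 2) :
    ∃ κ : ℝ, 0 < κ ∧ ∀ p : ℂ, 0 < p.re → κ * max 1 (‖p‖ ^ α) ≤ ‖1 + p ^ (α : ℂ)‖ := by
  have hπ := Real.pi_pos
  set k : ℝ := -Real.cos (α * (π / 2)) with hk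
  have hk0 : 0 < k := by
    have := Real.cos_neg_of_pi_div_two_lt_of_lt (x := α * (π / 2)) (by nlinarith) (by nlinarith)
    linarith
  have hk1 : k < 1 := by
    have := Real.cos_lt_cos_of_nonneg_of_le_pi (x := α * (π / 2)) (y := π) (by positivity)
      le_rfl (by nlinarith)
    rw [Real.cos_pi] at this
    linarith
  refine ⟨√(1 - k), Real.sqrt_pos.2 (by linarith), fun p hp => ?_⟩
  set r := ‖p‖ ^ α
  have hr : 0 ≤ r := by positivity
  have harg := Complex.abs_arg_lt_pi_div_two_iff.2 (Or.inl hp)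
  have hcos : -k ≤ Real.cos (p.arg * α) := by
    rw [hk, neg_neg, ← Real.cos_abs (p.arg * α)]
    refine Real.cos_le_cos_of_nonneg_of_le_pi (abs_nonneg _) (by nlinarith) ?_
    rw [abs_mul, abs_of_pos (by linarith : 0 < α)]
    nlinarith
  have hn : ‖1 + p ^ (α : ℂ)‖ ^ 2 = 1 + 2 * (r * Real.cos (p.arg * α)) + r ^ 2 := by
    have h3 := Complex.cpow_ofReal_re p α
    have h4 := Complex.norm_cpow_real p α
    rw [← Complex.normSq_eq_norm_sq, Complex.normSq_add, Complex.normSq_one,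
      Complex.normSq_eq_norm_sq, h4]
    simp [h3, r]
    ring
  refine le_of_sq_le_sq ?_ (norm_nonneg _)
  rw [hn, mul_pow, Real.sq_sqrt (by linarith)]
  have hm : (max 1 r) ^ 2 ≤ 1 + r ^ 2 := by
    rcases max_cases 1 r with h | h <;> rw [h.1] <;> nlinarith [sq_nonneg r]
  have h5 : (1 - k) * (max 1 r) ^ 2 ≤ (1 - k) * (1 + r ^ 2) :=
    mul_le_mul_of_nonneg_left hm (by linarith)
  nlinarith [mul_le_mul_of_nonneg_left hcos hr, mul_nonneg hk0.le (sq_nonneg (1 - r))]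

/-- An integrable envelope for the Laplace transforms on vertical lines. -/
noncomputable def lineEnvelope (α x : ℝ) : ℝ := if |x| ≤ 1 then |x| ^ (α - 2) else |x| ^ (-α)

lemma integrable_lineEnvelope {α : ℝ} (h1 : 1 < α) : Integrable (lineEnvelope α) := by
  have hI : IntegrableOn (fun x : ℝ => if x ≤ 1 then x ^ (α - 2) else x ^ (-α)) (Ioi 0) := by
    rw [← Ioc_union_Ioi_eq_Ioi zero_le_one]
    refine IntegrableOn.union ?_ ?_
    · have : IntegrableOn (fun x : ℝ => x ^ (α - 2)) (Ioc 0 1) :=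
        (intervalIntegrable_iff_integrableOn_Ioc_of_le zero_le_one).1
          (intervalIntegral.intervalIntegrable_rpow' (by linarith))
      refine this.congr_fun (fun x hx => ?_) measurableSet_Ioc
      simp [hx.2]
    · refine (integrableOn_Ioi_rpow_of_lt (by linarith : -α < -1) one_pos).congr_fun
        (fun x hx => ?_) measurableSet_Ioi
      have : ¬ x ≤ 1 := not_le.2 hx
      simp [this]
  have hI' := (integrable_indicator_iff measurableSet_Ioi).2 hI
  refine (hI'.add hI'.comp_neg).congr ?_
  filter_upwards [compl_mem_ae_iff.2 (measure_singleton (0 : ℝ))] with x hx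
  rcases lt_or_gt_of_ne (show x ≠ 0 from hx) with h | h
  · simp [lineEnvelope, indicator, h, not_lt.2 h.le, abs_of_neg h]
  · simp [lineEnvelope, indicator, h, not_lt.2 h.le, abs_of_pos h]

lemma tendsto_lineEnvelope {α : ℝ} (h1 : 1 < α) {l : Filter ℝ} (hl : Tendsto (|·|) l atTop) :
    Tendsto (lineEnvelope α) l (𝓝 0) := by
  refine ((tendsto_rpow_neg_atTop (by linarith : 0 < α)).comp hl).congr' ?_
  filter_upwards [hl.eventually (eventually_gt_atTop 1)] with x hx
  simp [lineEnvelope, not_le.2 hx]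

lemma le_lineEnvelope {α r x : ℝ} (h1 : 1 < α) (h2 : α < 2) (hx : x ≠ 0) (hr : |x| ≤ r) :
    1 / max 1 (r ^ α) ≤ lineEnvelope α x ∧
      r ^ (α - 2) / max 1 (r ^ α) ≤ lineEnvelope α x := by
  have hx0 : 0 < |x| := abs_pos.2 hx
  have hr0 : 0 < r := hx0.trans_le hr
  have hm1 : 1 ≤ max 1 (r ^ α) := le_max_left _ _
  have hm2 : r ^ α ≤ max 1 (r ^ α) := le_max_right _ _
  have e1 : r ^ (α - 2) ≤ |x| ^ (α - 2) :=
    Real.rpow_le_rpow_of_nonpos hx0 hr (by linarith)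
  have hi1 : 1 / max 1 (r ^ α) ≤ 1 := by
    rw [div_le_one (by linarith)]; exact hm1
  have hi0 : 0 ≤ 1 / max 1 (r ^ α) := by positivity
  rw [lineEnvelope]
  split_ifs with h
  · have e2 : 1 ≤ |x| ^ (α - 2) := Real.one_le_rpow_of_pos_of_le_one_of_nonpos hx0 h (by linarith)
    refine ⟨hi1.trans e2, ?_⟩
    exact (div_le_self (by positivity) hm1).trans e1
  · have e2 : 1 / max 1 (r ^ α) ≤ |x| ^ (-α) := by
      rw [Real.rpow_neg hx0.le, ← one_div]
      refine one_div_le_one_div_of_le (by positivity) (le_trans ?_ hm2)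
      exact Real.rpow_le_rpow hx0.le hr (by linarith)
    refine ⟨e2, le_trans ?_ e2⟩
    gcongr
    exact Real.rpow_le_one_of_one_le_of_nonpos ((not_le.1 h).le.trans hr) (by linarith)

lemma hasDerivAt_cpow_of_re_pos (α : ℝ) {p : ℂ} (hp : 0 < p.re) :
    HasDerivAt (fun z : ℂ => z ^ (α : ℂ)) (α * p ^ (α : ℂ) / p) p := by
  have hp0 : p ≠ 0 := by rintro rfl; simp at hp
  convert! (hasDerivAt_id p).cpow_const (c := (α : ℂ)) (Or.inl hp) using 1
  rw [id, Complex.cpow_sub _ _ hp0, Complex.cpow_one]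
  ring

lemma one_add_cpow_ne_zero {α : ℝ} (h1 : 1 < α) (h2 : α < 2) {p : ℂ} (hp : 0 < p.re) :
    1 + p ^ (α : ℂ) ≠ 0 := by
  obtain ⟨κ, hκ, h⟩ := exists_norm_one_add_cpow_ge h1 h2
  have := h p hp
  rw [← norm_pos_iff]
  refine lt_of_lt_of_le ?_ this
  positivity

lemma hasDerivAt_inv_one_add_cpow {α : ℝ} (h1 : 1 < α) (h2 : α < 2) {p : ℂ} (hp : 0 < p.re) :
    HasDerivAt (fun z : ℂ => 1 / (1 + z ^ (α : ℂ)))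
      (-(α * p ^ (α : ℂ) / (p * (1 + p ^ (α : ℂ)) ^ 2))) p := by
  have hp0 : p ≠ 0 := by rintro rfl; simp at hp
  have hA := one_add_cpow_ne_zero h1 h2 hp
  have := ((hasDerivAt_cpow_of_re_pos α hp).const_add 1).inv hA
  simp only [one_div]
  convert! this using 1
  field_simp

lemma hasDerivAt_div_one_add_cpow {α : ℝ} (h1 : 1 < α) (h2 : α < 2) {p : ℂ} (hp : 0 < p.re) :
    HasDerivAt (fun z : ℂ => z / (1 + z ^ (α : ℂ)))
      (-((-1 + (α - 1) * p ^ (α : ℂ)) / (1 + p ^ (α : ℂ)) ^ 2)) p := by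
  have hp0 : p ≠ 0 := by rintro rfl; simp at hp
  have hA := one_add_cpow_ne_zero h1 h2 hp
  have := (hasDerivAt_id p).div ((hasDerivAt_cpow_of_re_pos α hp).const_add 1) hA
  convert! this using 1
  simp only [id]
  field_simp
  ring

lemma hasDerivAt_cpow_div_one_add_cpow_sq {α : ℝ} (h1 : 1 < α) (h2 : α < 2) {p : ℂ}
    (hp : 0 < p.re) :
    HasDerivAt (fun z : ℂ => α * z ^ (α : ℂ) / (z * (1 + z ^ (α : ℂ)) ^ 2))
      (-(α * p ^ (α : ℂ) / p ^ 2 *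
        (2 * α * p ^ (α : ℂ) / (1 + p ^ (α : ℂ)) ^ 3 - (α - 1) / (1 + p ^ (α : ℂ)) ^ 2))) p := by
  have hp0 : p ≠ 0 := by rintro rfl; simp at hp
  have hA := one_add_cpow_ne_zero h1 h2 hp
  have hd := hasDerivAt_cpow_of_re_pos α hp
  have := (hd.const_mul (α : ℂ)).div ((hasDerivAt_id p).mul ((hd.const_add 1).pow 2))
    (mul_ne_zero hp0 (pow_ne_zero 2 hA))
  convert! this using 1
  simp only [id]
  field_simp
  simp
  ring

lemma differentiableOn_cpow_re_pos (α : ℝ) :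
    DifferentiableOn ℂ (fun z : ℂ => z ^ (α : ℂ)) {p | 0 < p.re} := fun _ hp =>
  (hasDerivAt_cpow_of_re_pos α hp).differentiableAt.differentiableWithinAt

lemma lap_mlKernel_of_one_lt {α b : ℝ} (h1 : 1 < α) (hb : 0 < b) {Ψ : ℂ → ℂ}
    (hΨ : DifferentiableOn ℂ Ψ {p | 0 < p.re})
    (he : ∀ l : ℝ, 1 < l → Ψ l = ((l ^ (α - b) / (1 + l ^ α) : ℝ) : ℂ)) {p : ℂ}
    (hp : 1 < p.re) : lap (mlKernel α b) p = Ψ p := by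
  refine lap_eq_of_eq_on_real (c₀ := 1) (c₁ := 1) (fun c hc => (laplace_mlKernel h1 hb hc).1)
    (hΨ.mono fun p (hp : 1 < p.re) => one_pos.trans hp) (fun l hl => ?_) hp
  rw [lap_ofReal, (laplace_mlKernel h1 hb hl).2, he l hl]

/-- Differentiating a Laplace transform on a half-plane. -/
lemma lap_id_mul_eq {q : ℝ → ℝ} {c₀ : ℝ} {Ψ : ℂ → ℂ} {Ψ' p : ℂ}
    (h : ∀ c, c₀ < c → IntegrableOn (fun y => rexp (-(c * y)) * q y) (Ioi 0))
    (he : ∀ p : ℂ, c₀ < p.re → lap q p = Ψ p) (hp : c₀ < p.re) (hd : HasDerivAt Ψ (-Ψ') p) :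
    lap (fun y => y * q y) p = Ψ' := by
  have h1 := hasDerivAt_lap h hp
  have h2 : HasDerivAt (lap q) (-Ψ') p := by
    refine hd.congr_of_eventuallyEq ?_
    filter_upwards [(isOpen_re_gt c₀).mem_nhds hp] with z hz using he z hz
  exact neg_injective (h1.unique h2)

lemma ofReal_div_one_add_cpow {l : ℝ} (hl : 1 < l) (α d : ℝ) :
    (((l ^ d / (1 + l ^ α) : ℝ)) : ℂ) = (l : ℂ) ^ (d : ℂ) / (1 + (l : ℂ) ^ (α : ℂ)) := by
  have : 0 ≤ l := by linarith
  push_cast [Complex.ofReal_cpow this]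
  rfl

lemma tendsto_id_mul_mlKernel {α b : ℝ} (h1 : 1 < α) (hb : 0 < b) :
    Tendsto (fun y => y * mlKernel α b y) (𝓝[>] 0) (𝓝 0) := by
  have hc : Continuous fun y : ℝ => y ^ b * mittagLefflerNeg α b (y ^ α) :=
    (Real.continuous_rpow_const hb.le).mul ((continuous_mittagLefflerNeg h1 hb).comp
      (Real.continuous_rpow_const (by linarith)))
  have := (hc.tendsto 0).mono_left (nhdsWithin_le_nhds (s := Ioi 0))
  rw [Real.zero_rpow hb.ne', zero_mul] at this
  refine this.congr' ?_
  filter_upwards [self_mem_nhdsWithin] with y hy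
  have hy : 0 < y := hy
  rw [mlKernel, ← mul_assoc, ← Real.rpow_one_add' hy.le (by linarith)]
  congr 2; ring

lemma abs_id_mul_mlKernel_sub_one_le {α : ℝ} (h1 : 1 < α) (h2 : α < 2) :
    ∃ C : ℝ, ∀ y, 0 < y → |y * mlKernel α (α - 1) y| ≤ C := by
  obtain ⟨κ, hκ, hk⟩ := exists_norm_one_add_cpow_ge h1 h2
  have hb : 0 < α - 1 := by linarith
  have hd := differentiableOn_cpow_re_pos α
  have hne : ∀ p ∈ {p : ℂ | 0 < p.re}, 1 + p ^ (α : ℂ) ≠ 0 := fun p hp =>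
    one_add_cpow_ne_zero h1 h2 hp
  have hi0 : ∀ c, 1 < c → IntegrableOn (fun y => rexp (-(c * y)) * mlKernel α (α - 1) y) (Ioi 0) :=
    fun c hc => (laplace_mlKernel h1 hb hc).1
  have hi := integrableOn_exp_mul_id_mul hi0
  refine ⟨(∫ x, 2 / κ ^ 2 * lineEnvelope α x) / (2 * π), fun y hy => ?_⟩
  rw [le_div_iff₀' (by positivity)]
  refine abs_le_of_lap_bound (q := fun y => y * mlKernel α (α - 1) y)
    (Ψ := fun p => (-1 + (α - 1) * p ^ (α : ℂ)) / (1 + p ^ (α : ℂ)) ^ 2)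
    (continuousOn_id.mul (continuousOn_mlKernel h1 hb)) (tendsto_id_mul_mlKernel h1 hb) hi
    ?_ ?_ ?_ ((integrable_lineEnvelope h1).const_mul _) ?_ ?_ hy
  · exact ((hd.const_mul _).const_add _).div ((hd.const_add _).pow 2)
      fun p hp => pow_ne_zero 2 (hne p hp)
  · intro p hp
    refine lap_id_mul_eq hi0 (Ψ := fun z : ℂ => z / (1 + z ^ (α : ℂ))) (fun z hz => ?_) hp
      (hasDerivAt_div_one_add_cpow h1 h2 (one_pos.trans hp))
    refine lap_mlKernel_of_one_lt h1 hb
      (Ψ := fun z : ℂ => z / (1 + z ^ (α : ℂ))) ?_ (fun l hl => ?_) hz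
    · exact differentiableOn_id.div (hd.const_add _) hne
    · rw [ofReal_div_one_add_cpow hl]
      simp
  · intro p hp him
    have hA := hk p hp
    set R := ‖p‖ ^ α with hR
    have hRn : ‖p ^ (α : ℂ)‖ = R := Complex.norm_cpow_real p α
    have hm1 : 1 ≤ max 1 R := le_max_left _ _
    have hm2 : R ≤ max 1 R := le_max_right _ _
    have hR0 : 0 ≤ R := by positivity
    have hnum : ‖-1 + ((α : ℂ) - 1) * p ^ (α : ℂ)‖ ≤ 2 * max 1 R := by
      refine (norm_add_le _ _).trans ?_
      rw [norm_neg, norm_one, norm_mul, hRn]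
      have : ‖(α : ℂ) - 1‖ ≤ 1 := by
        rw [← Complex.ofReal_one, ← Complex.ofReal_sub, Complex.norm_real, Real.norm_eq_abs, abs_le]
        constructor <;> linarith
      nlinarith
    have hB := (le_lineEnvelope h1 h2 him (Complex.abs_im_le_norm p)).1
    rw [norm_div, norm_pow]
    calc _ ≤ (2 * max 1 R) / (κ * max 1 R) ^ 2 := by gcongr
      _ = 2 / κ ^ 2 * (1 / max 1 R) := by field_simp
      _ ≤ _ := by gcongr
  · simpa using (tendsto_lineEnvelope h1 tendsto_abs_atTop_atTop).const_mul (2 / κ ^ 2)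
  · simpa using (tendsto_lineEnvelope h1 tendsto_abs_atBot_atTop).const_mul (2 / κ ^ 2)

lemma abs_sq_mul_mlKernel_le {α : ℝ} (h1 : 1 < α) (h2 : α < 2) :
    ∃ C : ℝ, ∀ y, 0 < y → |y * (y * mlKernel α α y)| ≤ C := by
  obtain ⟨κ, hκ, hk⟩ := exists_norm_one_add_cpow_ge h1 h2
  have hb : 0 < α := by linarith
  have hd := differentiableOn_cpow_re_pos α
  have hne : ∀ p ∈ {p : ℂ | 0 < p.re}, 1 + p ^ (α : ℂ) ≠ 0 := fun p hp =>
    one_add_cpow_ne_zero h1 h2 hp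
  have hp0 : ∀ p ∈ {p : ℂ | 0 < p.re}, p ≠ 0 := by
    rintro p hp rfl; simp at hp
  have hi0 : ∀ c, 1 < c → IntegrableOn (fun y => rexp (-(c * y)) * mlKernel α α y) (Ioi 0) :=
    fun c hc => (laplace_mlKernel h1 hb hc).1
  have hi1 := integrableOn_exp_mul_id_mul hi0
  have hi := integrableOn_exp_mul_id_mul hi1
  refine ⟨(∫ x, (2 / κ ^ 2 + 8 / κ ^ 3) * lineEnvelope α x) / (2 * π), fun y hy => ?_⟩
  rw [le_div_iff₀' (by positivity)]
  refine abs_le_of_lap_bound (q := fun y => y * (y * mlKernel α α y))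
    (Ψ := fun p => α * p ^ (α : ℂ) / p ^ 2 *
        (2 * α * p ^ (α : ℂ) / (1 + p ^ (α : ℂ)) ^ 3 - (α - 1) / (1 + p ^ (α : ℂ)) ^ 2))
    (continuousOn_id.mul (continuousOn_id.mul (continuousOn_mlKernel h1 hb))) ?_ hi
    ?_ ?_ ?_ ((integrable_lineEnvelope h1).const_mul _) ?_ ?_ hy
  · have := (tendsto_id.mono_left (nhdsWithin_le_nhds (a := (0 : ℝ)) (s := Ioi 0))).mul
      (tendsto_id_mul_mlKernel h1 hb)
    simpa using this
  · refine ((hd.const_mul _).div (differentiableOn_id.pow 2)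
      fun p hp => pow_ne_zero 2 (hp0 p hp)).mul ?_
    refine ((hd.const_mul _).div ((hd.const_add _).pow 3)
      fun p hp => pow_ne_zero 3 (hne p hp)).sub ?_
    exact (differentiableOn_const _).div ((hd.const_add _).pow 2)
      fun p hp => pow_ne_zero 2 (hne p hp)
  · intro p hp
    refine lap_id_mul_eq hi1 (Ψ := fun z : ℂ => α * z ^ (α : ℂ) / (z * (1 + z ^ (α : ℂ)) ^ 2))
      (fun z hz => ?_) hp (hasDerivAt_cpow_div_one_add_cpow_sq h1 h2 (one_pos.trans hp))
    refine lap_id_mul_eq hi0 (Ψ := fun z : ℂ => 1 / (1 + z ^ (α : ℂ))) (fun z hz => ?_) hz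
      (hasDerivAt_inv_one_add_cpow h1 h2 (one_pos.trans hz))
    refine lap_mlKernel_of_one_lt h1 hb
      (Ψ := fun z : ℂ => 1 / (1 + z ^ (α : ℂ))) ?_ (fun l hl => ?_) hz
    · exact (differentiableOn_const _).div (hd.const_add _) hne
    · rw [ofReal_div_one_add_cpow hl]
      simp
  · intro p hp him
    have hA := hk p hp
    have hpn : 0 < ‖p‖ := norm_pos_iff.2 (hp0 p hp)
    set R := ‖p‖ ^ α with hR
    have hRn : ‖p ^ (α : ℂ)‖ = R := Complex.norm_cpow_real p α
    have hm1 : 1 ≤ max 1 R := le_max_left _ _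
    have hm2 : R ≤ max 1 R := le_max_right _ _
    have hR0 : 0 ≤ R := by positivity
    have hB := (le_lineEnvelope h1 h2 him (Complex.abs_im_le_norm p)).2
    have hR2 : ‖p‖ ^ (α - 2) = R / ‖p‖ ^ 2 := by
      rw [Real.rpow_sub hpn, Real.rpow_two]
    have hα : ‖(α : ℂ)‖ = α := by rw [Complex.norm_real, Real.norm_of_nonneg hb.le]
    have hα1 : ‖(α : ℂ) - 1‖ = α - 1 := by
      rw [← Complex.ofReal_one, ← Complex.ofReal_sub, Complex.norm_real,
        Real.norm_of_nonneg (by linarith)]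
    set m := max 1 R with hm
    have hm0 : 0 < m := by linarith
    have e1 : ‖2 * α * p ^ (α : ℂ) / (1 + p ^ (α : ℂ)) ^ 3‖ ≤ 2 * α * m / (κ * m) ^ 3 := by
      rw [norm_div, norm_pow, norm_mul, norm_mul, hRn, hα, Complex.norm_two]
      gcongr
    have e2 : ‖((α : ℂ) - 1) / (1 + p ^ (α : ℂ)) ^ 2‖ ≤ (α - 1) / (κ * m) ^ 2 := by
      rw [norm_div, norm_pow, hα1]
      have : 0 ≤ α - 1 := by linarith
      gcongr
    have e3 : ‖(α : ℂ) * p ^ (α : ℂ) / p ^ 2‖ = α * ‖p‖ ^ (α - 2) := by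
      rw [norm_div, norm_mul, hRn, hα, norm_pow, hR2, mul_div_assoc]
    have e4 : 2 * α * m / (κ * m) ^ 3 + (α - 1) / (κ * m) ^ 2
        ≤ (4 / κ ^ 3 + 1 / κ ^ 2) * (1 / m) := by
      have : 2 * α * m / (κ * m) ^ 3 + (α - 1) / (κ * m) ^ 2
        = (2 * α / κ ^ 3 + (α - 1) / κ ^ 2) * (1 / m ^ 2) := by field_simp
      rw [this]
      have : m ≤ m ^ 2 := by nlinarith
      gcongr <;> linarith
    rw [norm_mul, e3]
    have hr := Real.rpow_nonneg (norm_nonneg p) (α - 2)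
    calc _ ≤ 2 * ‖p‖ ^ (α - 2) * ((4 / κ ^ 3 + 1 / κ ^ 2) * (1 / m)) := by
          gcongr
          exact (norm_sub_le _ _).trans ((add_le_add e1 e2).trans e4)
      _ = (2 / κ ^ 2 + 8 / κ ^ 3) * (‖p‖ ^ (α - 2) / m) := by ring
      _ ≤ _ := by gcongr
  · simpa using (tendsto_lineEnvelope h1 tendsto_abs_atTop_atTop).const_mul (2 / κ ^ 2 + 8 / κ ^ 3)
  · simpa using (tendsto_lineEnvelope h1 tendsto_abs_atBot_atTop).const_mul (2 / κ ^ 2 + 8 / κ ^ 3)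

lemma abs_mlKernel_le_rpow {α b : ℝ} (h1 : 1 < α) (hb : 0 < b) :
    ∃ C : ℝ, ∀ y ∈ Ioc (0 : ℝ) 1, |mlKernel α b y| ≤ C * y ^ (b - 1) := by
  obtain ⟨C, hC⟩ := isCompact_Icc.exists_bound_of_continuousOn (s := Icc (0 : ℝ) 1)
    (continuous_mittagLefflerNeg h1 hb).continuousOn
  refine ⟨C, fun y hy => ?_⟩
  have hy0 : 0 < y := hy.1
  rw [mlKernel, abs_mul, abs_of_nonneg (by positivity), mul_comm]
  refine mul_le_mul_of_nonneg_right (hC _ ⟨by positivity, ?_⟩) (by positivity)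
  exact Real.rpow_le_one hy0.le hy.2 (by linarith)

/-- A weight times a Mittag-Leffler kernel is integrable near zero. -/
lemma integrableOn_rpow_mul_mlKernel_Ioc {α b s : ℝ} (h1 : 1 < α) (hb : 0 < b)
    (hs : 0 < s + b) : IntegrableOn (fun y => y ^ s * mlKernel α b y) (Ioc 0 1) := by
  obtain ⟨C, hC⟩ := abs_mlKernel_le_rpow h1 hb
  have hI : IntegrableOn (fun y : ℝ => y ^ (s + b - 1)) (Ioc 0 1) :=
    (intervalIntegrable_iff_integrableOn_Ioc_of_le zero_le_one).1
      (intervalIntegral.intervalIntegrable_rpow' (by linarith))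
  refine (hI.const_mul C).mono' ?_ ?_
  · refine ContinuousOn.aestronglyMeasurable ?_ measurableSet_Ioc
    refine ContinuousOn.mul (fun y hy => ?_)
      ((continuousOn_mlKernel h1 hb).mono fun y hy => hy.1)
    exact (Real.continuousAt_rpow_const _ _ (Or.inl (ne_of_gt hy.1))).continuousWithinAt
  · refine (ae_restrict_iff' measurableSet_Ioc).2 (.of_forall fun y hy => ?_)
    have hy0 : 0 < y := hy.1
    rw [norm_mul, Real.norm_of_nonneg (by positivity), Real.norm_eq_abs,
      show s + b - 1 = s + (b - 1) by ring, Real.rpow_add hy0]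
    calc _ ≤ y ^ s * (C * y ^ (b - 1)) := by gcongr; exact hC y hy
      _ = _ := by ring

lemma integrableOn_exp_mul_mlKernel {α b : ℝ} (h1 : 1 < α) (hb : 0 < b) {C : ℝ}
    (hC : ∀ y, 1 < y → |mlKernel α b y| ≤ C) {c : ℝ} (hc : 0 < c) :
    IntegrableOn (fun y => rexp (-(c * y)) * mlKernel α b y) (Ioi 0) := by
  have hm : ContinuousOn (fun y => rexp (-(c * y)) * mlKernel α b y) (Ioi 0) :=
    (by fun_prop : Continuous fun y => rexp (-(c * y))).continuousOn.mul
      (continuousOn_mlKernel h1 hb)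
  rw [← Ioc_union_Ioi_eq_Ioi zero_le_one]
  refine IntegrableOn.union ?_ ?_
  · have := integrableOn_rpow_mul_mlKernel_Ioc (s := 0) h1 hb (by linarith)
    simp only [Real.rpow_zero, one_mul] at this
    refine this.norm.mono' ((hm.mono fun y hy => hy.1).aestronglyMeasurable measurableSet_Ioc) ?_
    refine (ae_restrict_iff' measurableSet_Ioc).2 (.of_forall fun y hy => ?_)
    rw [norm_mul, Real.norm_of_nonneg (Real.exp_pos _).le]
    refine mul_le_of_le_one_left (norm_nonneg _) (Real.exp_le_one_iff.2 ?_)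
    have := mul_nonneg hc.le hy.1.le
    linarith
  · refine ((exp_neg_integrableOn_Ioi 1 hc).mul_const C).mono' ((hm.mono
      (Ioi_subset_Ioi zero_le_one)).aestronglyMeasurable measurableSet_Ioi) ?_
    refine (ae_restrict_iff' measurableSet_Ioi).2 (.of_forall fun y hy => ?_)
    rw [norm_mul, Real.norm_of_nonneg (Real.exp_pos _).le, neg_mul]
    exact mul_le_mul_of_nonneg_left (hC y hy) (Real.exp_pos _).le

lemma integrableOn_exp_mul_mlKernel_sub_one {α : ℝ} (h1 : 1 < α) (h2 : α < 2) :
    ∀ c, 0 < c → IntegrableOn (fun y => rexp (-(c * y)) * mlKernel α (α - 1) y) (Ioi 0) := by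
  obtain ⟨C, hC⟩ := abs_id_mul_mlKernel_sub_one_le h1 h2
  refine fun c hc => integrableOn_exp_mul_mlKernel h1 (by linarith) (C := C) (fun y hy => ?_) hc
  have hy0 : 0 < y := by linarith
  refine le_trans ?_ (hC y hy0)
  rw [abs_mul, abs_of_pos hy0]
  exact le_mul_of_one_le_left (abs_nonneg _) hy.le

lemma integrableOn_exp_mul_mlKernel_self {α : ℝ} (h1 : 1 < α) (h2 : α < 2) :
    ∀ c, 0 < c → IntegrableOn (fun y => rexp (-(c * y)) * mlKernel α α y) (Ioi 0) := by
  obtain ⟨C, hC⟩ := abs_sq_mul_mlKernel_le h1 h2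
  refine fun c hc => integrableOn_exp_mul_mlKernel h1 (by linarith) (C := C) (fun y hy => ?_) hc
  have hy0 : 0 < y := by linarith
  refine le_trans ?_ (hC y hy0)
  rw [← mul_assoc, abs_mul, abs_of_pos (mul_pos hy0 hy0)]
  exact le_mul_of_one_le_left (abs_nonneg _) (by nlinarith)

lemma lap_mlKernel_sub_one {α : ℝ} (h1 : 1 < α) (h2 : α < 2) {p : ℂ} (hp : 0 < p.re) :
    lap (mlKernel α (α - 1)) p = p / (1 + p ^ (α : ℂ)) := by
  have hb : 0 < α - 1 := by linarith
  refine lap_eq_of_eq_on_real (c₀ := 0) (c₁ := 1) (Ψ := fun p => p / (1 + p ^ (α : ℂ)))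
    (integrableOn_exp_mul_mlKernel_sub_one h1 h2)
    (differentiableOn_id.div ((differentiableOn_cpow_re_pos α).const_add _)
      fun p hp => one_add_cpow_ne_zero h1 h2 hp) (fun l hl => ?_) hp
  rw [lap_ofReal, (laplace_mlKernel h1 hb hl).2, ofReal_div_one_add_cpow hl]
  simp

lemma lap_mlKernel_self {α : ℝ} (h1 : 1 < α) (h2 : α < 2) {p : ℂ} (hp : 0 < p.re) :
    lap (mlKernel α α) p = 1 / (1 + p ^ (α : ℂ)) := by
  have hb : 0 < α := by linarith
  refine lap_eq_of_eq_on_real (c₀ := 0) (c₁ := 1) (Ψ := fun p => 1 / (1 + p ^ (α : ℂ)))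
    (integrableOn_exp_mul_mlKernel_self h1 h2)
    ((differentiableOn_const _).div ((differentiableOn_cpow_re_pos α).const_add _)
      fun p hp => one_add_cpow_ne_zero h1 h2 hp) (fun l hl => ?_) hp
  rw [lap_ofReal, (laplace_mlKernel h1 hb hl).2, ofReal_div_one_add_cpow hl]
  simp

lemma laplace_id_mul_mlKernel_self {α : ℝ} (h1 : 1 < α) (h2 : α < 2) {l : ℝ} (hl : 0 < l) :
    ∫ y in Ioi 0, rexp (-(l * y)) * (y * mlKernel α α y)
      = α * l ^ (α - 1) / (1 + l ^ α) ^ 2 := by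
  have := lap_id_mul_eq (integrableOn_exp_mul_mlKernel_self h1 h2)
    (Ψ := fun z : ℂ => 1 / (1 + z ^ (α : ℂ))) (p := l)
    (fun p hp => lap_mlKernel_self h1 h2 hp) (by simpa using hl)
    (hasDerivAt_inv_one_add_cpow h1 h2 (by simpa using hl))
  rw [lap_ofReal, ← Complex.ofReal_cpow hl.le] at this
  norm_cast at this
  rw [this, Real.rpow_sub_one hl.ne']
  field_simp

/-- `mlKernel α α` is integrable against `y ^ s` for `-α < s < 1`. -/
lemma integrableOn_rpow_mul_mlKernel_self {α s : ℝ} (h1 : 1 < α) (h2 : α < 2) (hs0 : -α < s)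
    (hs1 : s < 1) : IntegrableOn (fun y => y ^ s * mlKernel α α y) (Ioi 0) := by
  obtain ⟨C, hC⟩ := abs_sq_mul_mlKernel_le h1 h2
  have hα : 0 < α := by linarith
  rw [← Ioc_union_Ioi_eq_Ioi zero_le_one]
  refine IntegrableOn.union (integrableOn_rpow_mul_mlKernel_Ioc h1 hα (by linarith)) ?_
  refine ((integrableOn_Ioi_rpow_of_lt (by linarith : s - 2 < -1) one_pos).const_mul C).mono' ?_ ?_
  · refine ContinuousOn.aestronglyMeasurable ?_ measurableSet_Ioi
    refine ContinuousOn.mul (fun y hy => ?_)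
      ((continuousOn_mlKernel h1 hα).mono (Ioi_subset_Ioi zero_le_one))
    exact (Real.continuousAt_rpow_const _ _ (Or.inl (ne_of_gt (one_pos.trans hy)))
      ).continuousWithinAt
  · refine (ae_restrict_iff' measurableSet_Ioi).2 (.of_forall fun y hy => ?_)
    have hy0 : 0 < y := one_pos.trans hy
    have := hC y hy0
    rw [← mul_assoc, abs_mul, abs_of_pos (by positivity)] at this
    rw [norm_mul, Real.norm_of_nonneg (by positivity), Real.norm_eq_abs,
      Real.rpow_sub hy0, Real.rpow_two, ← mul_div_assoc, le_div_iff₀ (by positivity)]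
    calc _ = y ^ s * (y * y * |mlKernel α α y|) := by ring
      _ ≤ y ^ s * C := by gcongr
      _ = _ := by ring

lemma sin_pi_div_pos {α : ℝ} (h1 : 1 < α) : 0 < Real.sin (π / α) :=
  Real.sin_pos_of_pos_of_lt_pi (by positivity) (div_lt_self Real.pi_pos h1)

lemma supDensity_term_eq {α x : ℝ} (h1 : 1 < α) (hx : 0 < x) (n : ℕ) :
    x ^ (α * ((n : ℝ) + 1) - 2) /
        (Real.Gamma (α * ((n : ℝ) + 1) - 1) * Real.Gamma (1 + 1 / α - ((n : ℝ) + 1)))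
      = Real.sin (π / α) / π * x⁻¹ * ((-1) ^ n * (Real.Gamma (n + (1 - 1 / α)) /
          Real.Gamma (α * n + (α - 1)) * (x ^ (-α)) ^ (-((n : ℝ) + (1 - 1 / α))))) := by
  have hα : 0 < α := by linarith
  have hs := sin_pi_div_pos h1
  have hc : 0 < 1 - 1 / α := by
    have : 1 / α < 1 := by rw [div_lt_one hα]; exact h1
    linarith
  have hG := Real.Gamma_pos_of_pos (by positivity : 0 < (n : ℝ) + (1 - 1 / α))
  have h := Real.Gamma_mul_Gamma_one_sub ((n : ℝ) + (1 - 1 / α))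
  have hsin : Real.sin (π * (n + (1 - 1 / α))) = (-1) ^ n * Real.sin (π / α) := by
    rw [show π * (n + (1 - 1 / α)) = (π - π / α) + n * π by ring, Real.sin_add_nat_mul_pi,
      Real.sin_pi_sub]
  have hG2 : Real.Gamma (1 + 1 / α - ((n : ℝ) + 1))
      = π / ((-1) ^ n * Real.sin (π / α)) / Real.Gamma (n + (1 - 1 / α)) := by
    rw [eq_div_iff hG.ne', ← hsin, ← h, mul_comm]
    congr 2; ring
  have hG3 := Real.Gamma_pos_of_pos (by
    have : 0 < α - 1 := by linarith
    positivity : 0 < α * n + (α - 1))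
  have hpow : x ^ (α * ((n : ℝ) + 1) - 2)
      = x⁻¹ * (x ^ (-α)) ^ (-((n : ℝ) + (1 - 1 / α))) := by
    rw [← Real.rpow_mul hx.le, ← Real.rpow_neg_one, ← Real.rpow_add hx]
    congr 1
    field_simp
    ring
  have h11 : ((-1 : ℝ) ^ n) * (-1) ^ n = 1 := by rw [← mul_pow]; simp
  have hn : (-1 : ℝ) ^ n ≠ 0 := by positivity
  rw [hG2, show α * ((n : ℝ) + 1) - 1 = α * n + (α - 1) by ring, hpow]
  field_simp

lemma summable_kernel_term {α b : ℝ} (h1 : 1 < α) (hb : 0 < b) :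
    Summable fun n : ℕ => Real.Gamma (n + (1 - 1 / α)) /
          Real.Gamma (α * n + (α - 1)) * b ^ (-((n : ℝ) + (1 - 1 / α))) := by
  have hα : 0 < α := by linarith
  have hc : 0 < 1 - 1 / α := by
    have : 1 / α < 1 := by rw [div_lt_one hα]; exact h1
    linarith
  have := (summable_pow_mul_Gamma_div_Gamma (b := α - 1) h1 (by linarith) hc
    (inv_pos.2 hb).le).mul_left (b ^ (-(1 - 1 / α)))
  refine this.congr fun n => ?_
  rw [neg_add, Real.rpow_add hb, Real.rpow_neg hb.le (n : ℝ), Real.rpow_natCast, inv_pow]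
  ring

lemma summable_abs_supDensity_term {α x : ℝ} (h1 : 1 < α) (hx : 0 < x) :
    Summable fun n : ℕ => |x ^ (α * ((n : ℝ) + 1) - 2) /
        (Real.Gamma (α * ((n : ℝ) + 1) - 1) * Real.Gamma (1 + 1 / α - ((n : ℝ) + 1)))| := by
  simp_rw [supDensity_term_eq h1 hx]
  refine Summable.abs (Summable.mul_left _ ?_)
  refine (summable_kernel_term h1 (by positivity : 0 < x ^ (-α))).abs.of_norm_bounded fun n => ?_
  rw [norm_mul, norm_pow, norm_neg, norm_one, one_pow, one_mul, Real.norm_eq_abs]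

lemma supDensity_eq {α x : ℝ} (h1 : 1 < α) (hx : 0 < x) :
    supDensity α x = Real.sin (π / α) / π * x⁻¹ *
      ∑' n : ℕ, (-1) ^ n * (Real.Gamma (n + (1 - 1 / α)) /
          Real.Gamma (α * n + (α - 1)) * (x ^ (-α)) ^ (-((n : ℝ) + (1 - 1 / α)))) := by
  rw [supDensity, ← tsum_mul_left]
  simp_rw [supDensity_term_eq h1 hx]

lemma integral_exp_neg_rpow_mul_mlKernel {α b : ℝ} (h1 : 1 < α) (hb : 0 < b) :
    IntegrableOn (fun y => rexp (-b * y ^ α) * mlKernel α (α - 1) y) (Ioi 0) ∧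
      ∫ y in Ioi 0, rexp (-b * y ^ α) * mlKernel α (α - 1) y
        = α⁻¹ * ∑' n : ℕ, (-1) ^ n * (Real.Gamma (n + (1 - 1 / α)) /
          Real.Gamma (α * n + (α - 1)) * b ^ (-((n : ℝ) + (1 - 1 / α)))) := by
  have hα : 0 < α := by linarith
  have hb1 : 0 < α - 1 := by linarith
  have hq : ∀ n : ℕ, -1 < α * n + (α - 1) - 1 := fun n => by
    have : 0 ≤ α * (n : ℝ) := by positivity
    linarith
  have hW : Continuous fun y : ℝ => rexp (-b * y ^ α) :=
    Real.continuous_exp.comp ((Real.continuous_rpow_const hα.le).const_mul _)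
  have := integral_mul_mlKernel h1 hb1 (W := fun y => rexp (-b * y ^ α))
    (V := fun n => α⁻¹ * (Real.Gamma (n + (1 - 1 / α)) * b ^ (-((n : ℝ) + (1 - 1 / α)))))
    hW.continuousOn (fun y _ => (Real.exp_pos _).le)
    (fun n => (integrableOn_rpow_mul_exp_neg_mul_rpow (hq n) hα hb).congr_fun
      (fun y _ => mul_comm _ _) measurableSet_Ioi) (fun n => ?_) ?_
  · refine ⟨this.1, this.2.trans ?_⟩
    rw [← tsum_mul_left]
    congr 1 with n
    ring
  · rw [← setIntegral_congr_fun measurableSet_Ioi (fun y _ => mul_comm (y ^ (α * n + (α - 1) - 1)) _),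
      integral_rpow_mul_exp_neg_mul_rpow hα (hq n) hb,
      show (α * n + (α - 1) - 1 + 1) / α = n + (1 - 1 / α) by field_simp; ring,
      show -(α * n + (α - 1) - 1 + 1) / α = -(n + (1 - 1 / α)) by field_simp; ring]
    ring
  · refine ((summable_kernel_term h1 hb).mul_left α⁻¹).congr fun n => ?_
    ring

lemma integral_rpow_mul_exp_neg_rpow_mul_mlKernel {α b : ℝ} (h1 : 1 < α) (hb : 0 < b) :
    IntegrableOn (fun y => (y ^ (α - 1) * rexp (-b * y ^ α)) * mlKernel α α y) (Ioi 0) ∧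
      ∫ y in Ioi 0, (y ^ (α - 1) * rexp (-b * y ^ α)) * mlKernel α α y
        = α⁻¹ ^ 2 * b⁻¹ * ∑' n : ℕ, (-1) ^ n * (Real.Gamma (n + (1 - 1 / α)) /
          Real.Gamma (α * n + (α - 1)) * b ^ (-((n : ℝ) + (1 - 1 / α)))) := by
  have hα : 0 < α := by linarith
  have hb1 : 0 < α - 1 := by linarith
  have hc : 0 < 1 - 1 / α := by
    have : 1 / α < 1 := by rw [div_lt_one hα]; exact h1
    linarith
  have hq : ∀ n : ℕ, -1 < α * n + (2 * α - 2) := fun n => by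
    have : 0 ≤ α * (n : ℝ) := by positivity
    linarith
  have hW : Continuous fun y : ℝ => y ^ (α - 1) * rexp (-b * y ^ α) :=
    (Real.continuous_rpow_const hb1.le).mul
      (Real.continuous_exp.comp ((Real.continuous_rpow_const hα.le).const_mul _))
  have he : ∀ n : ℕ, ∀ y ∈ Ioi (0 : ℝ), y ^ (α * n + (2 * α - 2)) * rexp (-b * y ^ α)
      = y ^ (α - 1) * rexp (-b * y ^ α) * y ^ (α * n + α - 1) := fun n y hy => by
    rw [show α * n + (2 * α - 2) = (α - 1) + (α * n + α - 1) by ring, Real.rpow_add hy]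
    ring
  have hterm : ∀ n : ℕ, α⁻¹ * (Real.Gamma ((n + (1 - 1 / α)) + 1) *
      b ^ (-((n : ℝ) + (1 - 1 / α) + 1))) / Real.Gamma (α * n + α)
      = α⁻¹ ^ 2 * b⁻¹ * (Real.Gamma (n + (1 - 1 / α)) /
          Real.Gamma (α * n + (α - 1)) * b ^ (-((n : ℝ) + (1 - 1 / α)))) := fun n => by
    have h3 : 0 < (n : ℝ) + (1 - 1 / α) := by positivity
    have h4 : α * n + (α - 1) = α * (n + (1 - 1 / α)) := by field_simp
    have h5 := Real.Gamma_pos_of_pos (by positivity : 0 < α * n + (α - 1))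
    rw [show α * n + α = (α * n + (α - 1)) + 1 by ring, Real.Gamma_add_one h3.ne',
      Real.Gamma_add_one (by positivity), neg_add, Real.rpow_add hb, Real.rpow_neg_one]
    rw [h4] at h5 ⊢
    generalize (n : ℝ) + (1 - 1 / α) = t at *
    field_simp
  have := integral_mul_mlKernel h1 hα (W := fun y => y ^ (α - 1) * rexp (-b * y ^ α))
    (V := fun n => α⁻¹ * (Real.Gamma ((n + (1 - 1 / α)) + 1) *
      b ^ (-((n : ℝ) + (1 - 1 / α) + 1))))
    hW.continuousOn (fun y hy => by positivity)
    (fun n => (integrableOn_rpow_mul_exp_neg_mul_rpow (hq n) hα hb).congr_fun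
      (he n) measurableSet_Ioi) (fun n => ?_) ?_
  · refine ⟨this.1, this.2.trans ?_⟩
    rw [← tsum_mul_left]
    congr 1 with n
    rw [hterm]
    ring
  · rw [← setIntegral_congr_fun measurableSet_Ioi (he n),
      integral_rpow_mul_exp_neg_mul_rpow hα (hq n) hb,
      show (α * n + (2 * α - 2) + 1) / α = n + (1 - 1 / α) + 1 by field_simp; ring,
      show -(α * n + (2 * α - 2) + 1) / α = -(n + (1 - 1 / α) + 1) by field_simp; ring]
    ring
  · simp_rw [hterm]
    exact (summable_kernel_term h1 hb).mul_left _

lemma supDensity_eq_integral_mlKernel_sub_one {α x : ℝ} (h1 : 1 < α) (hx : 0 < x) :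
    supDensity α x = Real.sin (π / α) / π * x⁻¹ * α *
      ∫ y in Ioi 0, rexp (-(x ^ (-α)) * y ^ α) * mlKernel α (α - 1) y := by
  rw [(integral_exp_neg_rpow_mul_mlKernel h1 (by positivity)).2, supDensity_eq h1 hx]
  field_simp

lemma supDensity_eq_integral_mlKernel_self {α x : ℝ} (h1 : 1 < α) (hx : 0 < x) :
    supDensity α x = Real.sin (π / α) / π * x ^ (-1 - α) * α ^ 2 *
      ∫ y in Ioi 0, (y ^ (α - 1) * rexp (-(x ^ (-α)) * y ^ α)) * mlKernel α α y := by
  have : x ^ (-1 - α) = x⁻¹ * x ^ (-α) := by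
    rw [sub_eq_add_neg, Real.rpow_add hx, Real.rpow_neg_one]
  have h0 : 0 < x ^ (-α) := by positivity
  rw [(integral_rpow_mul_exp_neg_rpow_mul_mlKernel h1 (by positivity)).2, supDensity_eq h1 hx,
    this]
  field_simp

/-- Functions with nonnegative cosine transform are stable under multiplication by the cosine
transform of a nonnegative weight. -/
lemma cos_transform_mul_nonneg {μ ν : Measure ℝ} [SFinite μ] [SFinite ν] {f w : ℝ → ℝ}
    (hf : Integrable f μ) (hp : ∀ a, 0 ≤ ∫ y, Real.cos (a * y) * f y ∂μ) (hw : Integrable w ν)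
    (hw0 : ∀ᵐ ξ ∂ν, 0 ≤ w ξ) :
    Integrable (fun y => (∫ ξ, Real.cos (y * ξ) * w ξ ∂ν) * f y) μ ∧
      ∀ a, 0 ≤ ∫ y, Real.cos (a * y) * ((∫ ξ, Real.cos (y * ξ) * w ξ ∂ν) * f y) ∂μ := by
  have hfw : Integrable (fun z : ℝ × ℝ => f z.1 * w z.2) (μ.prod ν) := hf.mul_prod hw
  have hI : ∀ a, Integrable (Function.uncurry fun y ξ : ℝ =>
      Real.cos (a * y) * Real.cos (y * ξ) * (f y * w ξ)) (μ.prod ν) := fun a => by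
    refine hfw.bdd_mul (c := 1)
      (f := fun z : ℝ × ℝ => Real.cos (a * z.1) * Real.cos (z.1 * z.2)) ?_ ?_
    · exact (by fun_prop : Continuous fun z : ℝ × ℝ =>
        Real.cos (a * z.1) * Real.cos (z.1 * z.2)).aestronglyMeasurable
    · refine .of_forall fun z => ?_
      rw [norm_mul]
      exact mul_le_one₀ (Real.abs_cos_le_one _) (norm_nonneg _) (Real.abs_cos_le_one _)
  have hrw : ∀ a y, ∫ ξ, Real.cos (a * y) * Real.cos (y * ξ) * (f y * w ξ) ∂ν
      = Real.cos (a * y) * ((∫ ξ, Real.cos (y * ξ) * w ξ ∂ν) * f y) := fun a y => by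
    rw [← integral_mul_const, ← integral_const_mul]
    congr 1 with ξ
    ring
  refine ⟨?_, fun a => ?_⟩
  · refine (hI 0).integral_prod_left.congr (.of_forall fun y => ?_)
    have := hrw 0 y
    simpa [Function.uncurry] using this
  · simp_rw [← hrw]
    rw [integral_integral_swap (hI a)]
    refine integral_nonneg_of_ae ?_
    filter_upwards [hw0] with ξ hξ
    have hc : ∀ b, Integrable (fun y => Real.cos (b * y) * f y) μ := fun b =>
      hf.bdd_mul (c := 1)
        (by fun_prop : Continuous fun y => Real.cos (b * y)).aestronglyMeasurable
        (.of_forall fun y => Real.abs_cos_le_one _)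
    have h1 : ∀ y, Real.cos (a * y) * Real.cos (y * ξ) * (f y * w ξ)
        = w ξ / 2 * (Real.cos ((a + ξ) * y) * f y + Real.cos ((a - ξ) * y) * f y) := fun y => by
      rw [add_mul, sub_mul, mul_comm ξ y, Real.cos_add, Real.cos_sub]
      ring
    simp_rw [h1]
    rw [integral_const_mul, integral_add (hc _) (hc _)]
    have := hp (a + ξ)
    have := hp (a - ξ)
    simp only [Pi.zero_apply]
    positivity

lemma cos_transform_pow_mul_nonneg {μ ν : Measure ℝ} [SFinite μ] [SFinite ν] {f w : ℝ → ℝ}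
    (hf : Integrable f μ) (hp : ∀ a, 0 ≤ ∫ y, Real.cos (a * y) * f y ∂μ) (hw : Integrable w ν)
    (hw0 : ∀ᵐ ξ ∂ν, 0 ≤ w ξ) (n : ℕ) :
    Integrable (fun y => (∫ ξ, Real.cos (y * ξ) * w ξ ∂ν) ^ n * f y) μ ∧
      ∀ a, 0 ≤ ∫ y, Real.cos (a * y) * ((∫ ξ, Real.cos (y * ξ) * w ξ ∂ν) ^ n * f y) ∂μ := by
  induction n with
  | zero => simpa using ⟨hf, hp⟩
  | succ n ih =>
    have := cos_transform_mul_nonneg ih.1 ih.2 hw hw0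
    simpa only [pow_succ', mul_assoc] using this

lemma integrableOn_one_sub_cos_mul_rpow {α t : ℝ} (h1 : 1 < α) (h2 : α < 2) :
    IntegrableOn (fun u => (1 - Real.cos (t * u)) * u ^ (-1 - α)) (Ioi 0) := by
  have hm : ContinuousOn (fun u => (1 - Real.cos (t * u)) * u ^ (-1 - α)) (Ioi 0) := by
    refine (by fun_prop : Continuous fun u => 1 - Real.cos (t * u)).continuousOn.mul
      fun u hu => ?_
    exact (Real.continuousAt_rpow_const _ _ (Or.inl (ne_of_gt hu))).continuousWithinAt
  rw [← Ioc_union_Ioi_eq_Ioi zero_le_one]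
  refine IntegrableOn.union ?_ ?_
  · have hI : IntegrableOn (fun u : ℝ => u ^ (1 - α)) (Ioc 0 1) :=
      (intervalIntegrable_iff_integrableOn_Ioc_of_le zero_le_one).1
        (intervalIntegral.intervalIntegrable_rpow' (by linarith))
    refine (hI.const_mul (t ^ 2 / 2)).mono' ((hm.mono fun y hy => hy.1).aestronglyMeasurable
      measurableSet_Ioc) ?_
    refine (ae_restrict_iff' measurableSet_Ioc).2 (.of_forall fun u hu => ?_)
    have hu0 : 0 < u := hu.1
    have hc := Real.one_sub_sq_div_two_le_cos (x := t * u)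
    have hc1 := Real.cos_le_one (t * u)
    rw [norm_mul, Real.norm_of_nonneg (by linarith), Real.norm_of_nonneg (by positivity),
      show 1 - α = 2 + (-1 - α) by ring, Real.rpow_add hu0, Real.rpow_two, ← mul_assoc]
    refine mul_le_mul_of_nonneg_right ?_ (by positivity)
    nlinarith
  · refine ((integrableOn_Ioi_rpow_of_lt (by linarith : -1 - α < -1) one_pos).const_mul 2).mono'
      ((hm.mono (Ioi_subset_Ioi zero_le_one)).aestronglyMeasurable measurableSet_Ioi) ?_
    refine (ae_restrict_iff' measurableSet_Ioi).2 (.of_forall fun u hu => ?_)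
    have hu0 : 0 < u := one_pos.trans hu
    have hc := Real.neg_one_le_cos (t * u)
    have hc1 := Real.cos_le_one (t * u)
    rw [norm_mul, Real.norm_of_nonneg (by linarith), Real.norm_of_nonneg (by positivity)]
    refine mul_le_mul_of_nonneg_right ?_ (by positivity)
    linarith

lemma integral_one_sub_cos_mul_rpow_pos {α : ℝ} (h1 : 1 < α) (h2 : α < 2) :
    0 < ∫ u in Ioi 0, (1 - Real.cos u) * u ^ (-1 - α) := by
  have hi := integrableOn_one_sub_cos_mul_rpow (t := 1) h1 h2
  simp only [one_mul] at hi
  rw [setIntegral_pos_iff_support_of_nonneg_ae ?_ hi]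
  · refine lt_of_lt_of_le ?_ (measure_mono (show Ioo (0 : ℝ) 1 ⊆ _ from fun u hu => ⟨?_, hu.1⟩))
    · simp
    · have hu0 : 0 < u := hu.1
      have := Real.cos_lt_cos_of_nonneg_of_le_pi (x := 0) (y := u) le_rfl
        (by linarith [hu.2, Real.pi_gt_three]) hu0
      rw [Real.cos_zero] at this
      have : 0 < (1 - Real.cos u) * u ^ (-1 - α) := mul_pos (by linarith) (by positivity)
      exact this.ne'
  · refine (ae_restrict_iff' measurableSet_Ioi).2 (.of_forall fun u hu => ?_)
    have hu0 : 0 < u := hu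
    have hc1 := Real.cos_le_one u
    exact mul_nonneg (by linarith) (by positivity)

lemma integral_one_sub_cos_mul_rpow {α t : ℝ} (ht : 0 < t) :
    ∫ u in Ioi 0, (1 - Real.cos (t * u)) * u ^ (-1 - α)
      = t ^ α * ∫ u in Ioi 0, (1 - Real.cos u) * u ^ (-1 - α) := by
  have h := integral_comp_mul_left_Ioi (fun u => (1 - Real.cos u) * u ^ (-1 - α)) 0 ht
  rw [mul_zero, smul_eq_mul] at h
  have e : ∫ u in Ioi 0, (1 - Real.cos (t * u)) * (t * u) ^ (-1 - α)
      = t ^ (-1 - α) * ∫ u in Ioi 0, (1 - Real.cos (t * u)) * u ^ (-1 - α) := by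
    rw [← integral_const_mul]
    refine setIntegral_congr_fun measurableSet_Ioi fun u hu => ?_
    rw [Real.mul_rpow ht.le (le_of_lt hu)]
    ring
  rw [e] at h
  have h3 : t ^ (-1 - α) = t⁻¹ * (t ^ α)⁻¹ := by
    rw [sub_eq_add_neg, Real.rpow_add ht, Real.rpow_neg_one, Real.rpow_neg ht.le]
  have h4 : 0 < t ^ α := by positivity
  rw [h3] at h
  field_simp at h ⊢
  linarith

lemma integral_exp_neg_rpow_mul_nonneg {α b : ℝ} (h1 : 1 < α) (h2 : α < 2) (hb : 0 < b)
    {f : ℝ → ℝ} (hf : IntegrableOn f (Ioi 0))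
    (hp : ∀ a, 0 ≤ ∫ y in Ioi 0, Real.cos (a * y) * f y) :
    0 ≤ ∫ y in Ioi 0, rexp (-b * y ^ α) * f y := by
  have hα : 0 < α := by linarith
  set c := ∫ u in Ioi 0, (1 - Real.cos u) * u ^ (-1 - α)
  have hc : 0 < c := integral_one_sub_cos_mul_rpow_pos h1 h2
  set β := b / c
  have hβ : 0 < β := by positivity
  set δ : ℕ → ℝ := fun n => (α * n / β) ^ (-(1 / α))
  set w : ℕ → ℝ → ℝ := fun n ξ => β / n * ξ ^ (-1 - α)
  set φ : ℕ → ℝ → ℝ := fun n t => ∫ ξ in Ioi (δ n), Real.cos (t * ξ) * w n ξ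
  have hδ : ∀ n, 0 < n → 0 < δ n := fun n hn => by
    have : (0 : ℝ) < n := by exact_mod_cast hn
    positivity
  have hw0 : ∀ n, 0 < n → ∀ ξ ∈ Ioi (δ n), 0 ≤ w n ξ := fun n hn ξ hξ => by
    have : 0 < ξ := (hδ n hn).trans hξ
    positivity
  have hw : ∀ n, 0 < n → IntegrableOn (w n) (Ioi (δ n)) := fun n hn =>
    (integrableOn_Ioi_rpow_of_lt (by linarith) (hδ n hn)).const_mul _
  have hw1 : ∀ n, 0 < n → ∫ ξ in Ioi (δ n), w n ξ = 1 := fun n hn => by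
    have hn' : (0 : ℝ) < n := by exact_mod_cast hn
    rw [integral_const_mul, integral_Ioi_rpow_of_lt (by linarith) (hδ n hn),
      show -1 - α + 1 = -α by ring, ← Real.rpow_mul (by positivity),
      show -(1 / α) * -α = 1 by field_simp, Real.rpow_one]
    field_simp
  have hcw : ∀ n, 0 < n → ∀ t, IntegrableOn (fun ξ => Real.cos (t * ξ) * w n ξ) (Ioi (δ n)) :=
    fun n hn t => (hw n hn).bdd_mul (c := 1)
      (by fun_prop : Continuous fun y => Real.cos (t * y)).aestronglyMeasurable
      (.of_forall fun y => Real.abs_cos_le_one _)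
  have hφ1 : ∀ n, 0 < n → ∀ t, |φ n t| ≤ 1 := fun n hn t => by
    rw [← Real.norm_eq_abs]
    refine (norm_integral_le_of_norm_le (hw n hn) ?_).trans_eq (hw1 n hn)
    refine (ae_restrict_iff' measurableSet_Ioi).2 (.of_forall fun ξ hξ => ?_)
    rw [norm_mul, Real.norm_of_nonneg (hw0 n hn ξ hξ)]
    exact mul_le_of_le_one_left (hw0 n hn ξ hξ) (Real.abs_cos_le_one _)
  have hδt : Tendsto δ atTop (𝓝 0) := by
    refine (tendsto_rpow_neg_atTop (by positivity : 0 < 1 / α)).comp ?_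
    refine Tendsto.atTop_div_const hβ ?_
    exact tendsto_natCast_atTop_atTop.const_mul_atTop hα
  have hlim : ∀ t, 0 < t → Tendsto (fun n => φ n t ^ n) atTop (𝓝 (rexp (-b * t ^ α))) := by
    intro t ht
    have h3 : Tendsto (fun n : ℕ => (n : ℝ) * (φ n t - 1)) atTop (𝓝 (-b * t ^ α)) := by
      have h4 := (aecover_Ioi_of_Ioi (μ := (volume : Measure ℝ)) hδt
        ).integral_tendsto_of_countably_generated
          (integrableOn_one_sub_cos_mul_rpow (t := t) h1 h2)
      rw [integral_one_sub_cos_mul_rpow ht] at h4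
      have h5 := h4.const_mul (-β)
      have h6 : -β * (t ^ α * c) = -b * t ^ α := by
        simp only [β]; field_simp
      rw [h6] at h5
      refine h5.congr' ?_
      filter_upwards [eventually_gt_atTop 0] with n hn
      have hn' : (0 : ℝ) < n := by exact_mod_cast hn
      have e : φ n t - 1 = ∫ ξ in Ioi (δ n), (Real.cos (t * ξ) * w n ξ - w n ξ) := by
        rw [integral_sub (hcw n hn t) (hw n hn), hw1 n hn]
      rw [Measure.restrict_restrict measurableSet_Ioi,
        inter_eq_left.2 (Ioi_subset_Ioi (hδ n hn).le), e, ← integral_const_mul,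
        ← integral_const_mul]
      congr 1 with ξ
      simp only [w]
      field_simp
      ring
    refine (Real.tendsto_one_add_pow_exp_of_tendsto h3).congr fun n => ?_
    rw [add_sub_cancel]
  have hcone : ∀ n, 0 < n → _ := fun n hn => cos_transform_pow_mul_nonneg hf hp (hw n hn)
    ((ae_restrict_iff' measurableSet_Ioi).2 (.of_forall (hw0 n hn))) n
  have ht := tendsto_integral_filter_of_dominated_convergence (μ := volume.restrict (Ioi (0 : ℝ)))
    (F := fun n y => φ n y ^ n * f y) (l := atTop) (f := fun y => rexp (-b * y ^ α) * f y)
    (fun y => ‖f y‖) ?_ ?_ hf.norm ?_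
  · refine ge_of_tendsto ht ?_
    filter_upwards [eventually_gt_atTop 0] with n hn
    simpa using (hcone n hn).2 0
  · filter_upwards [eventually_gt_atTop 0] with n hn using (hcone n hn).1.1
  · filter_upwards [eventually_gt_atTop 0] with n hn
    refine .of_forall fun y => ?_
    rw [norm_mul, norm_pow]
    exact mul_le_of_le_one_left (norm_nonneg _) (pow_le_one₀ (norm_nonneg _) (hφ1 n hn y))
  · refine (ae_restrict_iff' measurableSet_Ioi).2 (.of_forall fun y hy => ?_)
    exact (hlim y hy).mul_const _

lemma re_div_one_add_cpow_nonneg {α : ℝ} (h1 : 1 < α) (h2 : α < 2) {p : ℂ} (hp : 0 < p.re) :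
    0 ≤ (p / (1 + p ^ (α : ℂ))).re := by
  have harg := Complex.abs_arg_lt_pi_div_two_iff.2 (Or.inl hp)
  have hcos : 0 ≤ Real.cos ((α - 1) * p.arg) := by
    rw [← Real.cos_abs]
    refine Real.cos_nonneg_of_mem_Icc ⟨?_, ?_⟩
    · linarith [abs_nonneg ((α - 1) * p.arg), Real.pi_pos]
    · rw [abs_mul, abs_of_pos (by linarith)]
      nlinarith [abs_nonneg p.arg]
  have e : (p / (1 + p ^ (α : ℂ))).re
      = (p.re + ‖p‖ ^ α * ‖p‖ * Real.cos ((α - 1) * p.arg)) /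
        Complex.normSq (1 + p ^ (α : ℂ)) := by
    rw [Complex.div_re, ← add_div]
    congr 1
    rw [show (α - 1) * p.arg = p.arg * α - p.arg by ring, Real.cos_sub]
    simp only [Complex.add_re, Complex.one_re, Complex.add_im, Complex.one_im,
      Complex.cpow_ofReal_re, Complex.cpow_ofReal_im]
    linear_combination -(‖p‖ ^ α * Real.cos (p.arg * α)) * Complex.norm_mul_cos_arg p -
      (‖p‖ ^ α * Real.sin (p.arg * α)) * Complex.norm_mul_sin_arg p
  rw [e]
  exact div_nonneg (by positivity) (Complex.normSq_nonneg _)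

lemma cos_transform_exp_mul_mlKernel_nonneg {α ε : ℝ} (h1 : 1 < α) (h2 : α < 2) (hε : 0 < ε)
    (a : ℝ) : 0 ≤ ∫ y in Ioi 0, Real.cos (a * y) * (rexp (-(ε * y)) * mlKernel α (α - 1) y) := by
  set p : ℂ := ε + a * Complex.I
  have hpre : p.re = ε := by simp [p]
  have hpim : p.im = a := by simp [p]
  have h := re_div_one_add_cpow_nonneg h1 h2 (hpre ▸ hε : 0 < p.re)
  rw [← lap_mlKernel_sub_one h1 h2 (hpre ▸ hε : 0 < p.re), lap] at h
  have hi := integrableOn_cexp_mul (p := p) (hpre ▸ integrableOn_exp_mul_mlKernel_sub_one h1 h2 ε hε)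
  have h3 := integral_re hi
  refine (h.trans_eq h3.symm).trans_eq ?_
  congr 1 with y
  rw [RCLike.re_eq_complex_re, Complex.mul_re, Complex.exp_re]
  simp [hpre, hpim]
  ring

lemma supDensity_nonneg {α x : ℝ} (h1 : 1 < α) (h2 : α < 2) (hx : 0 < x) :
    0 ≤ supDensity α x := by
  have hb : 0 < x ^ (-α) := by positivity
  have hs := sin_pi_div_pos h1
  rw [supDensity_eq_integral_mlKernel_sub_one h1 hx]
  refine mul_nonneg (by positivity) ?_
  have hI := (integral_exp_neg_rpow_mul_mlKernel h1 hb).1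
  have hm : ContinuousOn (mlKernel α (α - 1)) (Ioi 0) := continuousOn_mlKernel h1 (by linarith)
  set ε : ℕ → ℝ := fun n => 1 / ((n : ℝ) + 1)
  have hε : ∀ n, 0 < ε n := fun n => by positivity
  have ht := tendsto_integral_of_dominated_convergence (μ := volume.restrict (Ioi (0 : ℝ)))
    (F := fun n y => rexp (-(x ^ (-α)) * y ^ α) * (rexp (-(ε n * y)) * mlKernel α (α - 1) y))
    (f := fun y => rexp (-(x ^ (-α)) * y ^ α) * mlKernel α (α - 1) y)
    (fun y => ‖rexp (-(x ^ (-α)) * y ^ α) * mlKernel α (α - 1) y‖) (fun n => ?_) hI.norm ?_ ?_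
  · refine ge_of_tendsto' ht fun n => ?_
    exact integral_exp_neg_rpow_mul_nonneg h1 h2 hb
      (integrableOn_exp_mul_mlKernel_sub_one h1 h2 _ (hε n))
      (cos_transform_exp_mul_mlKernel_nonneg h1 h2 (hε n))
  · refine ContinuousOn.aestronglyMeasurable ?_ measurableSet_Ioi
    have hW : Continuous fun y : ℝ => rexp (-(x ^ (-α)) * y ^ α) :=
      Real.continuous_exp.comp ((Real.continuous_rpow_const (by linarith)).const_mul _)
    exact hW.continuousOn.mul
      ((by fun_prop : Continuous fun y => rexp (-(ε n * y))).continuousOn.mul hm)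
  · refine fun n => (ae_restrict_iff' measurableSet_Ioi).2 (.of_forall fun y hy => ?_)
    rw [norm_mul, norm_mul, norm_mul, Real.norm_of_nonneg (Real.exp_pos (-(ε n * y))).le]
    refine mul_le_mul_of_nonneg_left ?_ (norm_nonneg _)
    refine mul_le_of_le_one_left (norm_nonneg _) (Real.exp_le_one_iff.2 ?_)
    have := mul_nonneg (hε n).le (le_of_lt hy)
    linarith
  · refine .of_forall fun y => ?_
    have h3 : Tendsto (fun n => rexp (-(ε n * y))) atTop (𝓝 1) := by
      have : Continuous fun e : ℝ => rexp (-(e * y)) := by fun_prop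
      have := (this.tendsto 0).comp (tendsto_one_div_add_atTop_nhds_zero_nat (𝕜 := ℝ))
      simpa [Function.comp_def, ε] using this
    simpa using (h3.mul_const (mlKernel α (α - 1) y)).const_mul (rexp (-(x ^ (-α)) * y ^ α))

lemma integral_integral_kernel_mul {K : ℝ → ℝ → ℝ} {f M : ℝ → ℝ}
    (hK : ContinuousOn (Function.uncurry K) (Ioi 0 ×ˢ Ioi 0))
    (hK0 : ∀ x y, 0 < x → 0 < y → 0 ≤ K x y) (hf : ContinuousOn f (Ioi 0))
    (hi : ∀ y, 0 < y → IntegrableOn (fun x => K x y) (Ioi 0))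
    (hM : ∀ y, 0 < y → ∫ x in Ioi 0, K x y = M y)
    (hMf : IntegrableOn (fun y => M y * f y) (Ioi 0)) :
    ∫ x in Ioi 0, ∫ y in Ioi 0, K x y * f y = ∫ y in Ioi 0, M y * f y := by
  have hm : AEStronglyMeasurable (Function.uncurry fun x y => K x y * f y)
      ((volume.restrict (Ioi (0 : ℝ))).prod (volume.restrict (Ioi (0 : ℝ)))) := by
    rw [Measure.prod_restrict]
    refine ContinuousOn.aestronglyMeasurable ?_ (measurableSet_Ioi.prod measurableSet_Ioi)
    exact hK.mul (hf.comp continuousOn_snd fun z hz => hz.2)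
  have hI : Integrable (Function.uncurry fun x y => K x y * f y)
      ((volume.restrict (Ioi (0 : ℝ))).prod (volume.restrict (Ioi (0 : ℝ)))) := by
    rw [integrable_prod_iff' hm]
    constructor
    · exact (ae_restrict_iff' measurableSet_Ioi).2
        (.of_forall fun y hy => (hi y hy).mul_const (f y))
    · refine hMf.norm.congr ((ae_restrict_iff' measurableSet_Ioi).2 (.of_forall fun y hy => ?_))
      simp only [Function.uncurry]
      have hM0 : 0 ≤ M y := by
        rw [← hM y hy]
        exact setIntegral_nonneg measurableSet_Ioi fun x hx => hK0 x y hx hy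
      rw [norm_mul, Real.norm_of_nonneg hM0, ← hM y hy, ← integral_mul_const]
      refine setIntegral_congr_fun measurableSet_Ioi fun x hx => ?_
      rw [norm_mul, Real.norm_of_nonneg (hK0 x y hx hy)]
  rw [integral_integral_swap hI]
  refine setIntegral_congr_fun measurableSet_Ioi fun y hy => ?_
  rw [integral_mul_const, hM y hy]

lemma integrableOn_rpow_mul_exp_neg_mul {w r : ℝ} (hw : -1 < w) (hr : 0 < r) :
    IntegrableOn (fun t => t ^ w * rexp (-(r * t))) (Ioi 0) := by
  refine (integrableOn_rpow_mul_exp_neg_mul_rpow hw one_pos hr).congr_fun (fun t _ => ?_)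
    measurableSet_Ioi
  simp

lemma integral_rpow_mul_exp_neg_mul {w r : ℝ} (hw : -1 < w) (hr : 0 < r) :
    ∫ t in Ioi 0, t ^ w * rexp (-(r * t)) = r ^ (-(w + 1)) * Real.Gamma (w + 1) := by
  have := Real.integral_rpow_mul_exp_neg_mul_Ioi (a := w + 1) (by linarith) hr
  rw [add_sub_cancel_right] at this
  rw [this, one_div, Real.inv_rpow hr.le, Real.rpow_neg hr.le]

lemma continuousOn_fst_rpow (w : ℝ) :
    ContinuousOn (fun z : ℝ × ℝ => z.1 ^ w) (Ioi 0 ×ˢ Ioi 0) :=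
  continuousOn_fst.rpow_const fun _ hz => Or.inl (ne_of_gt hz.1)

lemma continuousOn_rpow_mul_exp_neg_mul (w : ℝ) :
    ContinuousOn (Function.uncurry fun t y : ℝ => t ^ w * rexp (-(y * t)))
      (Ioi 0 ×ˢ Ioi 0) :=
  (continuousOn_fst_rpow w).mul
    (by fun_prop : Continuous fun z : ℝ × ℝ => rexp (-(z.2 * z.1))).continuousOn

lemma integral_rpow_div_one_add_sq {w : ℝ} (hw : -1 < w) (hw1 : w < 1) :
    ∫ u in Ioi 0, u ^ w / (1 + u) ^ 2 = Real.Gamma (1 + w) * Real.Gamma (1 - w) := by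
  have he : ∀ t ∈ Ioi (0 : ℝ), Real.Gamma (w + 1) * (t ^ (-w) * rexp (-(1 * t)))
      = t ^ (-(w + 1)) * Real.Gamma (w + 1) * (t ^ (1 : ℝ) * rexp (-t)) := fun t ht => by
    rw [show -w = -(w + 1) + 1 by ring, Real.rpow_add ht, one_mul]
    ring
  have h := integral_integral_kernel_mul (K := fun u t => u ^ w * rexp (-(t * u)))
    (f := fun t => t ^ (1 : ℝ) * rexp (-t)) (M := fun t => t ^ (-(w + 1)) * Real.Gamma (w + 1))
    (continuousOn_rpow_mul_exp_neg_mul w)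
    (fun u t hu ht => by positivity) (by
      simp only [Real.rpow_one]
      exact (by fun_prop : Continuous fun t => t * rexp (-t)).continuousOn)
    (fun t ht => integrableOn_rpow_mul_exp_neg_mul hw ht)
    (fun t ht => integral_rpow_mul_exp_neg_mul hw ht)
    (IntegrableOn.congr_fun (Integrable.const_mul
      (integrableOn_rpow_mul_exp_neg_mul (by linarith : -1 < -w) one_pos) _)
      he measurableSet_Ioi)
  rw [← setIntegral_congr_fun measurableSet_Ioi he, integral_const_mul,
    integral_rpow_mul_exp_neg_mul (by linarith) one_pos, Real.one_rpow, one_mul] at h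
  rw [add_comm 1 w, show 1 - w = -w + 1 by ring, ← h]
  refine setIntegral_congr_fun measurableSet_Ioi fun u hu => ?_
  have hu' : 0 < u := hu
  have h3 : ∀ t, u ^ w * rexp (-(t * u)) * (t ^ (1 : ℝ) * rexp (-t))
      = u ^ w * (t ^ (1 : ℝ) * rexp (-((1 + u) * t))) := fun t => by
    rw [show -((1 + u) * t) = -(t * u) + -t by ring, Real.exp_add]
    ring
  simp only [h3]
  rw [integral_const_mul, integral_rpow_mul_exp_neg_mul (by norm_num) (by linarith),
    Real.rpow_neg (by linarith)]
  norm_num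
  rfl

lemma integral_rpow_mul_mlKernel_self {α s : ℝ} (h1 : 1 < α) (h2 : α < 2) (hs0 : 1 - α < s)
    (hs1 : s < α) :
    Real.Gamma (2 - s) * ∫ y in Ioi 0, y ^ (s - 1) * mlKernel α α y
      = Real.Gamma (1 + (1 - s) / α) * Real.Gamma (1 - (1 - s) / α) := by
  have hα : 0 < α := by linarith
  have he : ∀ y ∈ Ioi (0 : ℝ), Real.Gamma (2 - s) * (y ^ (s - 1) * mlKernel α α y)
      = y ^ (-(1 - s + 1)) * Real.Gamma (1 - s + 1) * (y * mlKernel α α y) := fun y hy => by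
    have hy' : 0 < y := hy
    rw [show s - 1 = -(1 - s + 1) + 1 by ring, Real.rpow_add hy', Real.rpow_one,
      show 2 - s = 1 - s + 1 by ring]
    ring
  have h := integral_integral_kernel_mul (K := fun l y => l ^ (1 - s) * rexp (-(y * l)))
    (f := fun y => y * mlKernel α α y)
    (M := fun y => y ^ (-(1 - s + 1)) * Real.Gamma (1 - s + 1))
    (continuousOn_rpow_mul_exp_neg_mul (1 - s))
    (fun u t hu ht => by positivity) (continuousOn_id.mul (continuousOn_mlKernel h1 hα))
    (fun t ht => integrableOn_rpow_mul_exp_neg_mul (by linarith) ht)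
    (fun t ht => integral_rpow_mul_exp_neg_mul (by linarith) ht)
    (IntegrableOn.congr_fun (Integrable.const_mul
      (integrableOn_rpow_mul_mlKernel_self h1 h2 (by linarith : -α < s - 1) (by linarith)) _)
      he measurableSet_Ioi)
  rw [← setIntegral_congr_fun measurableSet_Ioi he, integral_const_mul] at h
  have hw0 : -1 < (1 - s) / α := by rw [lt_div_iff₀ hα]; linarith
  have hw1 : (1 - s) / α < 1 := by rw [div_lt_one hα]; linarith
  rw [← h, ← integral_rpow_div_one_add_sq hw0 hw1,
    ← integral_comp_rpow_Ioi_of_pos (g := fun u : ℝ => u ^ ((1 - s) / α) / (1 + u) ^ 2) hα]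
  refine setIntegral_congr_fun measurableSet_Ioi fun l hl => ?_
  have hl' : 0 < l := hl
  simp only [mul_assoc]
  rw [integral_const_mul]
  have h3 := laplace_id_mul_mlKernel_self h1 h2 hl'
  simp_rw [mul_comm l] at h3
  rw [h3, smul_eq_mul, ← Real.rpow_mul hl'.le, mul_div_cancel₀ _ hα.ne']
  ring

lemma integrableOn_rpow_mul_exp_neg_rpow_neg_mul {α s y : ℝ} (hα : 0 < α) (hs : s < α)
    (hy : 0 < y) :
    IntegrableOn (fun x => x ^ (s - 1 - α) * rexp (-(x ^ (-α)) * y ^ α)) (Ioi 0) ∧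
      ∫ x in Ioi 0, x ^ (s - 1 - α) * rexp (-(x ^ (-α)) * y ^ α)
        = α⁻¹ * Real.Gamma (1 - s / α) * y ^ (s - α) := by
  have hq : -1 < -(s / α) := by
    have : s / α < 1 := by rw [div_lt_one hα]; exact hs
    linarith
  have hyα : 0 < y ^ α := by positivity
  have hα' : -α ≠ 0 := by linarith [hα]
  have he : ∀ x ∈ Ioi (0 : ℝ), α⁻¹ * ((|-α| * x ^ (-α - 1)) •
      ((x ^ (-α)) ^ (-(s / α)) * rexp (-(y ^ α * x ^ (-α)))))
      = x ^ (s - 1 - α) * rexp (-(x ^ (-α)) * y ^ α) := fun x hx => by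
    have hx' : 0 < x := hx
    rw [abs_neg, abs_of_pos hα, ← Real.rpow_mul hx'.le, smul_eq_mul,
      show s - 1 - α = (-α - 1) + -α * -(s / α) by field_simp; ring, Real.rpow_add hx',
      show -(x ^ (-α)) * y ^ α = -(y ^ α * x ^ (-α)) by ring]
    field_simp
  constructor
  · refine IntegrableOn.congr_fun ?_ he measurableSet_Ioi
    exact ((integrableOn_Ioi_comp_rpow_iff _ hα').2
      (integrableOn_rpow_mul_exp_neg_mul hq hyα)).const_mul _
  · rw [← setIntegral_congr_fun measurableSet_Ioi he, integral_const_mul,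
      integral_comp_rpow_Ioi (fun t => t ^ (-(s / α)) * rexp (-(y ^ α * t))) hα',
      integral_rpow_mul_exp_neg_mul hq hyα, ← Real.rpow_mul hy.le,
      show α * -(-(s / α) + 1) = s - α by field_simp; ring,
      show -(s / α) + 1 = 1 - s / α by ring]
    ring

lemma integral_rpow_mul_supDensity {α s : ℝ} (h1 : 1 < α) (h2 : α < 2) (hs0 : 1 - α < s)
    (hs1 : s < α) :
    ∫ x in Ioi 0, x ^ s * supDensity α x
      = Real.sin (π / α) / π * α * Real.Gamma (1 - s / α) *
        ∫ y in Ioi 0, y ^ (s - 1) * mlKernel α α y := by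
  have hα : 0 < α := by linarith
  have he : ∀ y ∈ Ioi (0 : ℝ), α⁻¹ * Real.Gamma (1 - s / α) * (y ^ (s - 1) * mlKernel α α y)
      = α⁻¹ * Real.Gamma (1 - s / α) * y ^ (s - α) * (y ^ (α - 1) * mlKernel α α y) :=
    fun y hy => by
    have hy' : 0 < y := hy
    rw [show s - 1 = (s - α) + (α - 1) by ring, Real.rpow_add hy']
    ring
  have hKc : ContinuousOn (Function.uncurry fun x y : ℝ =>
      x ^ (s - 1 - α) * rexp (-(x ^ (-α)) * y ^ α)) (Ioi 0 ×ˢ Ioi 0) := by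
    refine (continuousOn_fst_rpow _).mul (Real.continuous_exp.comp_continuousOn ?_)
    exact (continuousOn_fst_rpow _).neg.mul
      ((Real.continuous_rpow_const hα.le).comp_continuousOn continuousOn_snd)
  have h := integral_integral_kernel_mul
    (K := fun x y => x ^ (s - 1 - α) * rexp (-(x ^ (-α)) * y ^ α))
    (f := fun y => y ^ (α - 1) * mlKernel α α y)
    (M := fun y => α⁻¹ * Real.Gamma (1 - s / α) * y ^ (s - α)) hKc
    (fun x y hx hy => by positivity)
    ((Real.continuous_rpow_const (by linarith)).continuousOn.mul (continuousOn_mlKernel h1 hα))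
    (fun y hy => (integrableOn_rpow_mul_exp_neg_rpow_neg_mul hα hs1 hy).1)
    (fun y hy => (integrableOn_rpow_mul_exp_neg_rpow_neg_mul hα hs1 hy).2)
    (IntegrableOn.congr_fun (Integrable.const_mul
      (integrableOn_rpow_mul_mlKernel_self h1 h2 (by linarith : -α < s - 1) (by linarith)) _)
      he measurableSet_Ioi)
  rw [← setIntegral_congr_fun measurableSet_Ioi he, integral_const_mul] at h
  have hx : ∀ x ∈ Ioi (0 : ℝ), Real.sin (π / α) / π * α ^ 2 * (∫ y in Ioi 0,
      x ^ (s - 1 - α) * rexp (-(x ^ (-α)) * y ^ α) * (y ^ (α - 1) * mlKernel α α y))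
      = x ^ s * supDensity α x := fun x hx => by
    have hx' : 0 < x := hx
    rw [supDensity_eq_integral_mlKernel_self h1 hx',
      show s - 1 - α = s + (-1 - α) by ring, Real.rpow_add hx',
      ← integral_const_mul, ← integral_const_mul, ← integral_const_mul]
    congr 1 with y
    ring
  rw [← setIntegral_congr_fun measurableSet_Ioi hx, integral_const_mul, h]
  field_simp

lemma mellin_supDensity {α s : ℝ} (h1 : 1 < α) (h2 : α < 2) (hs0 : 1 - α < s)
    (hs1 : s < α) (hs : s ≠ 1) :
    ∫ x in Ioi 0, x ^ s * supDensity α x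
      = Real.Gamma (1 - s / α) * Real.sin (π / α) /
            (Real.Gamma (1 - s) * Real.sin (π * (1 - s) / α)) := by
  have hα : 0 < α := by linarith
  have hs' : 1 - s ≠ 0 := sub_ne_zero.2 hs.symm
  have hG : 0 < Real.Gamma (2 - s) := Real.Gamma_pos_of_pos (by linarith)
  have h := integral_rpow_mul_mlKernel_self h1 h2 hs0 hs1
  have hw : (1 - s) / α ≠ 0 := div_ne_zero hs' hα.ne'
  rw [add_comm 1 ((1 - s) / α), Real.Gamma_add_one hw, mul_assoc,
    Real.Gamma_mul_Gamma_one_sub, mul_comm (Real.Gamma (2 - s)), ← eq_div_iff hG.ne'] at h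
  rw [integral_rpow_mul_supDensity h1 h2 hs0 hs1, h, show 2 - s = 1 - s + 1 by ring,
    Real.Gamma_add_one hs', mul_div_assoc π]
  rcases eq_or_ne (Real.sin (π * ((1 - s) / α))) 0 with h0 | h0
  · simp [h0]
  rcases eq_or_ne (Real.Gamma (1 - s)) 0 with h3 | h3
  · simp [h3]
  field_simp

end Auxiliary

/-- For every `α ∈ (1,2)`, the series defining `k_α(x)` converges
absolutely for every `x > 0`, `k_α` is nonnegative on `(0,∞)`, and for every real
`s` with `1 − α < s < α`, `s ≠ 1`, one has
`∫₀^∞ x^s k_α(x) dx = Γ(1−s/α) sin(π/α) / (Γ(1−s) sin(π(1−s)/α))`;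
in particular (taking `s = 0`) `∫₀^∞ k_α(x) dx = 1`. -/
theorem stmt_14 (α : ℝ) (hα : α ∈ Set.Ioo (1 : ℝ) 2) :
    (∀ x : ℝ, 0 < x →
      Summable (fun n : ℕ => |x ^ (α * ((n : ℝ) + 1) - 2) /
        (Real.Gamma (α * ((n : ℝ) + 1) - 1) * Real.Gamma (1 + 1 / α - ((n : ℝ) + 1)))|)) ∧
    (∀ x : ℝ, 0 < x → 0 ≤ supDensity α x) ∧
    (∀ s : ℝ, 1 - α < s → s < α → s ≠ 1 →
      ∫ x in Set.Ioi (0 : ℝ), x ^ s * supDensity α x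
        = Real.Gamma (1 - s / α) * Real.sin (π / α) /
            (Real.Gamma (1 - s) * Real.sin (π * (1 - s) / α))) ∧
    ∫ x in Set.Ioi (0 : ℝ), supDensity α x = 1 := by
  obtain ⟨h1, h2⟩ := hα
  refine ⟨fun x hx => summable_abs_supDensity_term h1 hx, fun x hx => supDensity_nonneg h1 h2 hx,
    fun s hs0 hs1 hs => mellin_supDensity h1 h2 hs0 hs1 hs, ?_⟩
  have h := mellin_supDensity (s := 0) h1 h2 (by linarith) (by linarith) zero_ne_one
  have h3 := (sin_pi_div_pos h1).ne'
  simpa [h3] using h
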